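/- arXiv:1902.05617 — 3 statements merged into one kernel-verified Lean document; each statement's English description precedes it below -/
import Mathlib

section
/- Let R = K[X_d,Y_d]^δ, let M be the free R-module with basis symbols A_1,…,A_d and W_{pq} (1 ≤ p, q ≤ d), and let φ : M → K[A_d,B_d,X_d,Y_d] be the R-linear map with φ(A_i) = a_i and φ(W_{pq}) = w_{pq}. Then the image of φ is exactly C_{2d}^δ = {f ∈ C_{2d} : δ(f) = 0}, and the kernel of φ is the R-submodule of M generated by the elements u_{jk}·A_i − x_j·W_{ik} + x_k·W_{ij} for 1 ≤ i ≤ d, 1 ≤ j < k ≤ d, together with the elements u_{kl}·W_{ij} − u_{jl}·W_{ik} + u_{jk}·W_{il} for 1 ≤ i ≤ d, 1 ≤ j < k < l ≤ d. (These are the defining relations of the R-module C_{2d}^δ with respect to the generators a_i, w_{pq}.) -/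
open MvPolynomial

set_option synthInstance.maxHeartbeats 1000000
set_option maxHeartbeats 2000000

noncomputable section

/-- The variables of `K[A_d,B_d,X_d,Y_d]`: `Sum.inl (Sum.inl i) = aᵢ`,
`Sum.inl (Sum.inr i) = bᵢ`, `Sum.inr (Sum.inl i) = xᵢ`, `Sum.inr (Sum.inr i) = yᵢ`. -/
abbrev Var4 (d : ℕ) : Type := (Fin d ⊕ Fin d) ⊕ (Fin d ⊕ Fin d)

variable (K : Type*) [Field K] (d : ℕ)

def aP (i : Fin d) : MvPolynomial (Var4 d) K := X (Sum.inl (Sum.inl i))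
def bP (i : Fin d) : MvPolynomial (Var4 d) K := X (Sum.inl (Sum.inr i))
def xP (i : Fin d) : MvPolynomial (Var4 d) K := X (Sum.inr (Sum.inl i))
def yP (i : Fin d) : MvPolynomial (Var4 d) K := X (Sum.inr (Sum.inr i))

/-- `u_{pq} = x_p y_q - x_q y_p`. -/
def uP (p q : Fin d) : MvPolynomial (Var4 d) K := xP K d p * yP K d q - xP K d q * yP K d p

/-- `w_{pq} = a_p y_q - b_p x_q`. -/
def wP (p q : Fin d) : MvPolynomial (Var4 d) K := aP K d p * yP K d q - bP K d p * xP K d q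

/-- The canonical embedding of `K[X_d,Y_d]` into `K[A_d,B_d,X_d,Y_d]`. -/
def embXY : MvPolynomial (Fin d ⊕ Fin d) K →ₐ[K] MvPolynomial (Var4 d) K := rename Sum.inr

/-- `C_{2d}`, the free `K[X_d,Y_d]`-module with basis `a₁,…,a_d,b₁,…,b_d`, viewed as a
subset of `K[A_d,B_d,X_d,Y_d]`. -/
def Cmod : Set (MvPolynomial (Var4 d) K) :=
  {f | ∃ F G : Fin d → MvPolynomial (Fin d ⊕ Fin d) K,
    f = ∑ i, aP K d i * embXY K d (F i) + ∑ i, bP K d i * embXY K d (G i)}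

/-- The generators of the module `L`. -/
def Lgens : Set (MvPolynomial (Var4 d) K) :=
  (Set.range fun i : Fin d => wP K d i i) ∪
  {g | ∃ i j : Fin d, i < j ∧ g = wP K d i j + wP K d j i} ∪
  {g | ∃ i j : Fin d, i < j ∧ g = aP K d i * xP K d j - aP K d j * xP K d i} ∪
  {g | ∃ i p q : Fin d, p < q ∧ g = aP K d i * uP K d p q - wP K d p q * xP K d i} ∪
  {g | ∃ i j k : Fin d, i < j ∧ j < k ∧
    g = aP K d i * uP K d j k - aP K d j * uP K d i k + aP K d k * uP K d i j} ∪
  {g | ∃ i j p q : Fin d, i < j ∧ p < q ∧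
    g = wP K d i j * uP K d p q - wP K d p q * uP K d i j}

/-- The `K[X_d,Y_d]^δ`-submodule `L` of `C_{2d}` generated by `Lgens`: the set of all
finite sums `Σ g·h` with `g ∈ Lgens` and `h` a constant of `δ` in (the image of)
`K[X_d,Y_d]`. -/
def Lsub (δ : Derivation K (MvPolynomial (Var4 d) K) (MvPolynomial (Var4 d) K)) :
    Submodule K (MvPolynomial (Var4 d) K) :=
  Submodule.span K {z | ∃ g ∈ Lgens K d, ∃ h : MvPolynomial (Fin d ⊕ Fin d) K,
    δ (embXY K d h) = 0 ∧ z = g * embXY K d h}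


/-- The kernel of a derivation, as a subalgebra. -/
def constAlg {A : Type*} [CommRing A] [Algebra K A] (δ : Derivation K A A) :
    Subalgebra K A where
  carrier := {f | δ f = 0}
  mul_mem' := by
    intro a b ha hb
    simp only [Set.mem_setOf_eq] at *
    rw [Derivation.leibniz, ha, hb]; simp
  add_mem' := by
    intro a b ha hb
    simp only [Set.mem_setOf_eq] at *
    rw [map_add, ha, hb]; simp
  algebraMap_mem' := fun r => by
    simp only [Set.mem_setOf_eq, Derivation.map_algebraMap]

/-- `R = K[X_d,Y_d]^δ`, realized as the subalgebra of `K[A_d,B_d,X_d,Y_d]` consisting of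
the constants of `δ` lying in the image of `K[X_d,Y_d]`. -/
def Rconst (δ : Derivation K (MvPolynomial (Var4 d) K) (MvPolynomial (Var4 d) K)) :
    Subalgebra K (MvPolynomial (Var4 d) K) :=
  (embXY K d).range ⊓ constAlg K δ

/-- The `R`-linear map `φ` from the free `R`-module with basis symbols `Aᵢ` (`i : Fin d`,
encoded `Sum.inl i`) and `W_{pq}` (`p q : Fin d`, encoded `Sum.inr (p, q)`) to
`K[A_d,B_d,X_d,Y_d]`, sending `Aᵢ ↦ aᵢ` and `W_{pq} ↦ w_{pq}`. -/
def phiMap (δ : Derivation K (MvPolynomial (Var4 d) K) (MvPolynomial (Var4 d) K)) :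
    ((Fin d ⊕ Fin d × Fin d) →₀ ↥(Rconst K d δ)) →ₗ[↥(Rconst K d δ)]
      MvPolynomial (Var4 d) K :=
  Finsupp.linearCombination ↥(Rconst K d δ)
    (Sum.elim (aP K d) (fun pq : Fin d × Fin d => wP K d pq.1 pq.2))

namespace BinaryPolarization

theorem exists_derivation_commutator {R A : Type*} [CommRing R] [CommRing A] [Algebra R A]
    (D₁ D₂ : Derivation R A A) : ∃ D : Derivation R A A, ∀ f, D f = D₁ (D₂ f) - D₂ (D₁ f) :=
  ⟨⁅D₁, D₂⁆, fun _ => Derivation.commutator_apply ..⟩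

variable {F : Type*} [Field F] {ι : Type*} [Fintype ι]

/-- The polarization derivation `∑ᵢ X (a i) ∂/∂X (b i)`. -/
def polarization (a b : ι → ι ⊕ ι) :
    Derivation F (MvPolynomial (ι ⊕ ι) F) (MvPolynomial (ι ⊕ ι) F) :=
  ∑ i, (X (a i) : MvPolynomial (ι ⊕ ι) F) • pderiv (b i)

theorem polarization_apply (a b : ι → ι ⊕ ι) (f : MvPolynomial (ι ⊕ ι) F) :
    polarization a b f = ∑ i, X (a i) * pderiv (b i) f := by
  have h := map_sum (Derivation.coeFnAddMonoidHom (R := F) (A := MvPolynomial (ι ⊕ ι) F)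
    (M := MvPolynomial (ι ⊕ ι) F))
    (fun i => (X (a i) : MvPolynomial (ι ⊕ ι) F) • pderiv (b i)) Finset.univ
  have h' := congr_fun h f
  rw [Finset.sum_apply] at h'
  exact h'

/-- The raising operator `∑ xᵢ ∂/∂yᵢ`. -/
abbrev raise : Derivation F (MvPolynomial (ι ⊕ ι) F) (MvPolynomial (ι ⊕ ι) F) :=
  polarization Sum.inl Sum.inr

/-- The lowering operator `∑ yᵢ ∂/∂xᵢ`. -/
abbrev lower : Derivation F (MvPolynomial (ι ⊕ ι) F) (MvPolynomial (ι ⊕ ι) F) :=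
  polarization Sum.inr Sum.inl

/-- The Euler operator `∑ xᵢ ∂/∂xᵢ`. -/
abbrev eulerX : Derivation F (MvPolynomial (ι ⊕ ι) F) (MvPolynomial (ι ⊕ ι) F) :=
  polarization Sum.inl Sum.inl

/-- The Euler operator `∑ yᵢ ∂/∂yᵢ`. -/
abbrev eulerY : Derivation F (MvPolynomial (ι ⊕ ι) F) (MvPolynomial (ι ⊕ ι) F) :=
  polarization Sum.inr Sum.inr

/-- The bidegree of a variable: `(1, 0)` for `xᵢ` and `(0, 1)` for `yᵢ`. -/
def bidegree : ι ⊕ ι → ℤ × ℤ := Sum.elim (fun _ => (1, 0)) (fun _ => (0, 1))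

theorem weight_bidegree (s : ι ⊕ ι →₀ ℕ) :
    Finsupp.weight bidegree s = (∑ i, (s (Sum.inl i) : ℤ), ∑ i, (s (Sum.inr i) : ℤ)) := by
  rw [Finsupp.weight_apply, Finsupp.sum_fintype _ _ (by simp), Fintype.sum_sum_type]
  simp [bidegree, Prod.ext_iff, Prod.fst_sum, Prod.snd_sum]

omit [Fintype ι] in
theorem pderiv_comm (i j : ι ⊕ ι) (f : MvPolynomial (ι ⊕ ι) F) :
    pderiv i (pderiv j f) = pderiv j (pderiv i f) := by
  classical
  obtain ⟨D, hD⟩ := exists_derivation_commutator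
    (pderiv i : Derivation F (MvPolynomial (ι ⊕ ι) F) _) (pderiv j)
  have h : D = 0 := derivation_ext fun k => by
    simp only [hD, pderiv_X, Pi.single_apply]
    split_ifs <;> simp
  rw [← sub_eq_zero, ← hD, h, Derivation.zero_apply]

variable [DecidableEq ι]

theorem polarization_X (a b : ι → ι ⊕ ι) (k : ι ⊕ ι) :
    polarization a b (X k : MvPolynomial (ι ⊕ ι) F) = ∑ i, if k = b i then X (a i) else 0 := by
  simp [polarization_apply, pderiv_X, Pi.single_apply, mul_ite]

theorem raise_lower (f : MvPolynomial (ι ⊕ ι) F) :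
    raise (lower f) = lower (raise f) + eulerX f - eulerY f := by
  obtain ⟨D, hD⟩ := exists_derivation_commutator
    (raise : Derivation F (MvPolynomial (ι ⊕ ι) F) _) lower
  have h : D = eulerX - eulerY := derivation_ext fun k => by
    rw [hD, Derivation.sub_apply]
    rcases k with k | k <;> simp [polarization_X]
  have := hD f
  rw [h, Derivation.sub_apply] at this
  linear_combination -this

theorem pderiv_polarization (a b : ι → ι ⊕ ι) (k : ι ⊕ ι) (f : MvPolynomial (ι ⊕ ι) F) :
    pderiv k (polarization a b f) =
      polarization a b (pderiv k f) + ∑ i, if a i = k then pderiv (b i) f else 0 := by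
  simp only [polarization_apply, map_sum, pderiv_mul, pderiv_X, Finset.sum_add_distrib,
    Pi.single_apply, ite_mul, one_mul, zero_mul, pderiv_comm k]
  rw [add_comm]

theorem pderiv_inl_raise (k : ι) (f : MvPolynomial (ι ⊕ ι) F) :
    pderiv (Sum.inl k) (raise f) = raise (pderiv (Sum.inl k) f) + pderiv (Sum.inr k) f := by
  simp [pderiv_polarization]

theorem pderiv_inr_raise (k : ι) (f : MvPolynomial (ι ⊕ ι) F) :
    pderiv (Sum.inr k) (raise f) = raise (pderiv (Sum.inr k) f) := by
  simp [pderiv_polarization]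

theorem pderiv_inr_lower (k : ι) (f : MvPolynomial (ι ⊕ ι) F) :
    pderiv (Sum.inr k) (lower f) = lower (pderiv (Sum.inr k) f) + pderiv (Sum.inl k) f := by
  simp [pderiv_polarization]

theorem raise_X_inl (k : ι) : raise (X (Sum.inl k) : MvPolynomial (ι ⊕ ι) F) = 0 := by
  simp [polarization_X]

theorem raise_X_inr (k : ι) :
    raise (X (Sum.inr k) : MvPolynomial (ι ⊕ ι) F) = X (Sum.inl k) := by
  simp [polarization_X]

theorem lower_X_inl (k : ι) :
    lower (X (Sum.inl k) : MvPolynomial (ι ⊕ ι) F) = X (Sum.inr k) := by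
  simp [polarization_X]

omit [DecidableEq ι] in
theorem isWeightedHomogeneous_polarization {a b : ι → ι ⊕ ι} {e m m' : ℤ × ℤ}
    (he : ∀ i, bidegree (a i) = bidegree (b i) + e) (hm : m + e = m')
    {f : MvPolynomial (ι ⊕ ι) F} (hf : IsWeightedHomogeneous bidegree f m) :
    IsWeightedHomogeneous bidegree (polarization a b f) m' := by
  rw [polarization_apply]
  refine IsWeightedHomogeneous.sum _ _ _ fun i _ => ?_
  have h := (isWeightedHomogeneous_X F bidegree (a i)).mul
    (hf.pderiv (i := b i) (n' := m - bidegree (b i)) (by abel))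
  rwa [show bidegree (a i) + (m - bidegree (b i)) = m' by rw [he, ← hm]; abel] at h

omit [Fintype ι] in
theorem coeff_X_mul_pderiv (k : ι ⊕ ι) (f : MvPolynomial (ι ⊕ ι) F) (s : ι ⊕ ι →₀ ℕ) :
    coeff s (X k * pderiv k f) = s k * coeff s f := by
  induction f using MvPolynomial.monomial_add_induction_on with
  | C a =>
    rcases eq_or_ne s 0 with rfl | hs
    · simp
    · simp [coeff_C, hs.symm]
  | monomial_add t c f _ _ ih =>
    rw [map_add, mul_add, coeff_add, ih, X_mul_pderiv_monomial, coeff_smul, coeff_add,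
      coeff_monomial]
    split_ifs with h
    · subst h; simp [mul_add]
    · simp

theorem eulerX_eq {p q : ℤ} {f : MvPolynomial (ι ⊕ ι) F}
    (hf : IsWeightedHomogeneous bidegree f (p, q)) : eulerX f = C (p : F) * f := by
  ext s
  rw [polarization_apply, coeff_sum, coeff_C_mul]
  simp only [coeff_X_mul_pderiv]
  by_cases h : coeff s f = 0
  · simp [h]
  · have := hf h
    rw [weight_bidegree, Prod.mk.injEq] at this
    rw [← Finset.sum_mul, ← this.1]
    push_cast; rfl

theorem eulerY_eq {p q : ℤ} {f : MvPolynomial (ι ⊕ ι) F}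
    (hf : IsWeightedHomogeneous bidegree f (p, q)) : eulerY f = C (q : F) * f := by
  ext s
  rw [polarization_apply, coeff_sum, coeff_C_mul]
  simp only [coeff_X_mul_pderiv]
  by_cases h : coeff s f = 0
  · simp [h]
  · have := hf h
    rw [weight_bidegree, Prod.mk.injEq] at this
    rw [← Finset.sum_mul, ← this.2]
    push_cast; rfl

omit [DecidableEq ι] in
theorem eq_zero_of_bidegree_neg {p q : ℤ} {f : MvPolynomial (ι ⊕ ι) F}
    (hf : IsWeightedHomogeneous bidegree f (p, q)) (h : p < 0 ∨ q < 0) : f = 0 := by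
  ext s
  by_contra hs
  have := hf hs
  rw [weight_bidegree, Prod.mk.injEq] at this
  have h1 : (0 : ℤ) ≤ ∑ i, (s (Sum.inl i) : ℤ) := Finset.sum_nonneg fun _ _ => by positivity
  have h2 : (0 : ℤ) ≤ ∑ i, (s (Sum.inr i) : ℤ) := Finset.sum_nonneg fun _ _ => by positivity
  lia

theorem derivation_map_C_mul {σ : Type*}
    (D : Derivation F (MvPolynomial σ F) (MvPolynomial σ F)) (c : F) (f : MvPolynomial σ F) :
    D (C c * f) = C c * D f := by
  rw [Derivation.leibniz, derivation_C, smul_zero, add_zero, smul_eq_mul]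

omit [DecidableEq ι] in
theorem isWeightedHomogeneous_raise {p q : ℤ} {f : MvPolynomial (ι ⊕ ι) F}
    (hf : IsWeightedHomogeneous bidegree f (p, q)) :
    IsWeightedHomogeneous bidegree (raise f) (p + 1, q - 1) :=
  isWeightedHomogeneous_polarization (e := (1, -1)) (by simp [bidegree])
    (by simp [sub_eq_add_neg]) hf

omit [DecidableEq ι] in
theorem isWeightedHomogeneous_lower {p q : ℤ} {f : MvPolynomial (ι ⊕ ι) F}
    (hf : IsWeightedHomogeneous bidegree f (p, q)) :
    IsWeightedHomogeneous bidegree (lower f) (p - 1, q + 1) :=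
  isWeightedHomogeneous_polarization (e := (-1, 1)) (by simp [bidegree])
    (by simp [sub_eq_add_neg]) hf

theorem raise_lower_eq {p q : ℤ} {f : MvPolynomial (ι ⊕ ι) F}
    (hf : IsWeightedHomogeneous bidegree f (p, q)) :
    raise (lower f) = lower (raise f) + C ((p : F) - q) * f := by
  rw [raise_lower, eulerX_eq hf, eulerY_eq hf, C_sub]
  ring

omit [DecidableEq ι] in
theorem isWeightedHomogeneous_lower_iterate {p q : ℤ} {f : MvPolynomial (ι ⊕ ι) F}
    (hf : IsWeightedHomogeneous bidegree f (p, q)) (k : ℕ) :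
    IsWeightedHomogeneous bidegree (lower^[k] f) (p - k, q + k) := by
  induction k with
  | zero => simpa using hf
  | succ k ih =>
    rw [Function.iterate_succ_apply']
    convert isWeightedHomogeneous_lower ih using 2 <;> push_cast <;> ring

theorem raise_lower_iterate {p q : ℤ} {f : MvPolynomial (ι ⊕ ι) F}
    (hf : IsWeightedHomogeneous bidegree f (p, q)) (h : lower (raise f) = 0) (k : ℕ) :
    raise (lower^[k + 1] f) = C (((k : F) + 1) * (p - q - k)) * lower^[k] f := by
  induction k with
  | zero => simp [raise_lower_eq hf, h]
  | succ k ih =>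
    rw [Function.iterate_succ_apply',
      raise_lower_eq (isWeightedHomogeneous_lower_iterate hf (k + 1)), ih, derivation_map_C_mul,
      ← Function.iterate_succ_apply' lower, ← add_mul, ← C_add]
    congr 2
    push_cast
    ring

variable [CharZero F]

theorem eq_zero_of_lower_raise_eq_zero {p q : ℤ} {f : MvPolynomial (ι ⊕ ι) F}
    (hf : IsWeightedHomogeneous bidegree f (p, q)) (hpq : p < q) (h : lower (raise f) = 0) :
    f = 0 := by
  have key : ∀ k : ℕ, lower^[k] f = 0 → f = 0 := by
    intro k
    induction k with
    | zero => exact id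
    | succ k ih =>
      intro hk
      have h1 := raise_lower_iterate hf h k
      rw [hk, map_zero, eq_comm, mul_eq_zero, C_eq_zero] at h1
      refine ih (h1.resolve_left ?_)
      have : ((k : ℤ) + 1) * (p - q - k) ≠ 0 := mul_ne_zero (by lia) (by lia)
      exact_mod_cast this
  exact key (p + 1).toNat
    (eq_zero_of_bidegree_neg (isWeightedHomogeneous_lower_iterate hf _) (Or.inl (by lia)))

theorem eq_zero_of_raise_eq_zero {p q : ℤ} {f : MvPolynomial (ι ⊕ ι) F}
    (hf : IsWeightedHomogeneous bidegree f (p, q)) (hpq : p < q) (h : raise f = 0) : f = 0 :=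
  eq_zero_of_lower_raise_eq_zero hf hpq (by rw [h, map_zero])

theorem lower_eq_zero_of_raise_eq_zero {p : ℤ} {f : MvPolynomial (ι ⊕ ι) F}
    (hf : IsWeightedHomogeneous bidegree f (p, p)) (h : raise f = 0) : lower f = 0 :=
  eq_zero_of_raise_eq_zero (isWeightedHomogeneous_lower hf) (by lia)
    (by rw [raise_lower_eq hf, h]; simp)

theorem eq_zero_of_raise_raise_eq_zero {p q : ℤ} {f : MvPolynomial (ι ⊕ ι) F}
    (hf : IsWeightedHomogeneous bidegree f (p, q)) (hpq : p + 2 ≤ q)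
    (h : raise (raise f) = 0) : f = 0 := by
  have hr := isWeightedHomogeneous_raise hf
  rcases hpq.eq_or_lt with rfl | hlt
  · refine eq_zero_of_lower_raise_eq_zero hf (by lia)
      (lower_eq_zero_of_raise_eq_zero (p := p + 1) ?_ h)
    convert hr using 2
    ring
  · exact eq_zero_of_raise_eq_zero hf (by lia) (eq_zero_of_raise_eq_zero hr (by lia) h)

/-- The operator `c ∂/∂xₖ + Δ ∂/∂yₖ`, where `Δ` is the lowering operator. For `c = p - q + 1` it
maps constants of the raising operator of bidegree `(p, q)` to constants. -/
def contract (c : F) (k : ι) (f : MvPolynomial (ι ⊕ ι) F) : MvPolynomial (ι ⊕ ι) F :=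
  C c * pderiv (Sum.inl k) f + lower (pderiv (Sum.inr k) f)

omit [CharZero F] [DecidableEq ι] [Fintype ι] in
theorem isWeightedHomogeneous_pderiv_inr {p q : ℤ} {f : MvPolynomial (ι ⊕ ι) F}
    (hf : IsWeightedHomogeneous bidegree f (p, q)) (k : ι) :
    IsWeightedHomogeneous bidegree (pderiv (Sum.inr k) f) (p, q - 1) :=
  hf.pderiv (by simp [bidegree])

omit [CharZero F] [DecidableEq ι] [Fintype ι] in
theorem isWeightedHomogeneous_pderiv_inl {p q : ℤ} {f : MvPolynomial (ι ⊕ ι) F}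
    (hf : IsWeightedHomogeneous bidegree f (p, q)) (k : ι) :
    IsWeightedHomogeneous bidegree (pderiv (Sum.inl k) f) (p - 1, q) :=
  hf.pderiv (by simp [bidegree])

omit [CharZero F] in
theorem raise_contract {p q : ℤ} {f : MvPolynomial (ι ⊕ ι) F}
    (hf : IsWeightedHomogeneous bidegree f (p, q)) (h : raise f = 0) (k : ι) :
    raise (contract ((p : F) - q + 1) k f) = 0 := by
  have h1 := pderiv_inl_raise k f
  have h2 := pderiv_inr_raise k f
  rw [h, map_zero] at h1 h2
  rw [contract, map_add, derivation_map_C_mul,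
    raise_lower_eq (isWeightedHomogeneous_pderiv_inr hf k), ← h2, map_zero]
  push_cast
  rw [show (p : F) - (q - 1) = p - q + 1 by ring]
  linear_combination -C ((p : F) - q + 1) * h1

omit [CharZero F] in
theorem sum_X_mul_lower (r : ι → MvPolynomial (ι ⊕ ι) F) :
    ∑ k, X (Sum.inl k) * lower (r k) =
      lower (∑ k, X (Sum.inl k) * r k) - ∑ k, X (Sum.inr k) * r k := by
  simp only [map_sum, Derivation.leibniz, lower_X_inl, smul_eq_mul, Finset.sum_add_distrib]
  simp only [mul_comm (r _)]
  ring

omit [CharZero F] in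
theorem sum_X_mul_contract {p q : ℤ} {f : MvPolynomial (ι ⊕ ι) F}
    (hf : IsWeightedHomogeneous bidegree f (p, q)) (h : raise f = 0) :
    ∑ k, X (Sum.inl k) * contract ((p : F) - q + 1) k f = C (((p : F) - q) * (p + 1)) * f := by
  have h1 := eulerX_eq hf
  have h2 := eulerY_eq hf
  rw [polarization_apply] at h1 h2 h
  have h3 := sum_X_mul_lower fun k => pderiv (Sum.inr k) f
  rw [h, h2, map_zero] at h3
  simp only [contract, mul_add, Finset.sum_add_distrib, h3, mul_left_comm (X _) (C _),
    ← Finset.mul_sum, h1]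
  simp only [map_add, map_sub, map_mul, map_one]
  ring

omit [CharZero F] in
theorem sum_X_mul_contract_sub {p q : ℤ} {r : ι → MvPolynomial (ι ⊕ ι) F}
    (hr : ∀ j, IsWeightedHomogeneous bidegree (r j) (p, q)) (h : ∀ j, raise (r j) = 0)
    (hs : ∑ k, X (Sum.inl k) * r k = 0) (j : ι) :
    ∑ k, X (Sum.inl k) *
        (contract ((p : F) - q + 1) k (r j) - contract ((p : F) - q + 1) j (r k)) =
      C (((p : F) - q) * (p + 2)) * r j + pderiv (Sum.inr j) (∑ k, X (Sum.inr k) * r k) := by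
  have h1 := congrArg (pderiv (Sum.inl j)) hs
  have h2 := congrArg (pderiv (Sum.inr j)) hs
  have h3 := sum_X_mul_lower fun k => pderiv (Sum.inr j) (r k)
  simp only [map_sum, pderiv_mul, pderiv_X, Pi.single_apply, Sum.inl.injEq, Sum.inr.injEq,
    reduceCtorEq, if_false, zero_mul, zero_add, ite_mul, one_mul, Finset.sum_add_distrib,
    map_zero, Finset.sum_ite_eq', Finset.mem_univ, if_true] at h1 h2 ⊢
  rw [h2, map_zero] at h3
  simp only [mul_sub, Finset.sum_sub_distrib, sum_X_mul_contract (hr j) (h j)]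
  simp only [contract, mul_add, Finset.sum_add_distrib, h3, mul_left_comm (X _) (C _),
    ← Finset.mul_sum]
  have h4 : (C 2 : MvPolynomial (ι ⊕ ι) F) = 2 := map_ofNat C 2
  simp only [map_add, map_sub, map_mul, map_one, h4]
  linear_combination -(C (p : F) - C (q : F) + 1) * h1

end BinaryPolarization

namespace BinaryPolarization
variable {F : Type*} [Field F] {ι : Type*} [Fintype ι]

omit [Fintype ι] in
theorem weightedHomogeneousComponent_map {σ M : Type*} [AddCancelCommMonoid M] {w : σ → M}
    (T : MvPolynomial σ F →ₗ[F] MvPolynomial σ F) (e : M)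
    (hT : ∀ m f, IsWeightedHomogeneous w f m → IsWeightedHomogeneous w (T f) (m + e))
    (m : M) (f : MvPolynomial σ F) :
    weightedHomogeneousComponent w (m + e) (T f) = T (weightedHomogeneousComponent w m f) := by
  classical
  suffices h : (weightedHomogeneousComponent w (m + e)).comp T =
      T.comp (weightedHomogeneousComponent w m) from LinearMap.congr_fun h f
  refine linearMap_ext fun s => LinearMap.ext fun c => ?_
  have h := isWeightedHomogeneous_monomial w s c rfl
  simp only [LinearMap.comp_apply]
  rw [weightedHomogeneousComponent_of_mem (n := Finsupp.weight w s) h,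
    weightedHomogeneousComponent_of_mem (n := Finsupp.weight w s + e) (hT _ _ h)]
  simp only [add_left_inj]
  split_ifs <;> simp

theorem component_raise (p q : ℤ) (f : MvPolynomial (ι ⊕ ι) F) :
    weightedHomogeneousComponent bidegree (p + 1, q - 1) (raise f) =
      raise (weightedHomogeneousComponent bidegree (p, q) f) :=
  weightedHomogeneousComponent_map (w := bidegree) (raise : Derivation F _ _).toLinearMap (1, -1)
    (fun m _ hf => isWeightedHomogeneous_raise (p := m.1) (q := m.2) hf) (p, q) f

theorem component_raise_eq_zero {f : MvPolynomial (ι ⊕ ι) F} (hf : raise f = 0) (m : ℤ × ℤ) :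
    raise (weightedHomogeneousComponent bidegree m f) = 0 := by
  rw [← Prod.mk.eta (p := m), ← component_raise, hf, map_zero]

omit [Fintype ι] in
theorem component_X_inl_mul (k : ι) (m : ℤ × ℤ) (f : MvPolynomial (ι ⊕ ι) F) :
    weightedHomogeneousComponent bidegree (m + (1, 0)) (X (Sum.inl k) * f) =
      X (Sum.inl k) * weightedHomogeneousComponent bidegree m f :=
  weightedHomogeneousComponent_map (w := bidegree)
    (LinearMap.mulLeft F (X (Sum.inl k) : MvPolynomial (ι ⊕ ι) F)) (1, 0)
    (fun m g hg => by
      rw [add_comm]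
      exact (isWeightedHomogeneous_X F bidegree (Sum.inl k)).mul hg) m f

theorem exists_finset_sum_component {σ M α : Type*} [Finite α] [AddCommMonoid M] (w : σ → M)
    (r : α → MvPolynomial σ F) :
    ∃ S : Finset M, ∀ j, ∑ m ∈ S, weightedHomogeneousComponent w m (r j) = r j := by
  have hfin : (⋃ j, Function.support fun m => weightedHomogeneousComponent w m (r j)).Finite :=
    Set.finite_iUnion fun j => weightedHomogeneousComponent_finsupp (r j)
  refine ⟨hfin.toFinset, fun j => ?_⟩
  conv_rhs => rw [← sum_weightedHomogeneousComponent w (r j)]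
  refine (finsum_eq_sum_of_support_subset _ ?_).symm
  rw [Set.Finite.coe_toFinset]
  exact Set.subset_iUnion (fun j => Function.support fun m =>
    weightedHomogeneousComponent w m (r j)) j

/-- The minor `xₚ y_q - x_q yₚ`. -/
def minor (p q : ι) : MvPolynomial (ι ⊕ ι) F :=
  X (Sum.inl p) * X (Sum.inr q) - X (Sum.inl q) * X (Sum.inr p)

/-- The vectors generated, over the constants of the raising operator, by the Koszul syzygies of
`x` and the Plücker syzygies. -/
def IsKoszulPlucker (r : ι → MvPolynomial (ι ⊕ ι) F) : Prop :=
  ∃ (s : ι → ι → MvPolynomial (ι ⊕ ι) F) (t : ι → ι → ι → MvPolynomial (ι ⊕ ι) F),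
    (∀ j k, raise (s j k) = 0) ∧ (∀ a b c, raise (t a b c) = 0) ∧
    ∀ j, r j = ∑ k, X (Sum.inl k) * (s j k - s k j) +
      ∑ b, ∑ c, minor b c * (t j b c - t b j c + t b c j)

theorem isKoszulPlucker_zero : IsKoszulPlucker (0 : ι → MvPolynomial (ι ⊕ ι) F) :=
  ⟨0, 0, by simp, by simp, by simp⟩

theorem IsKoszulPlucker.add {r r' : ι → MvPolynomial (ι ⊕ ι) F} (h : IsKoszulPlucker r)
    (h' : IsKoszulPlucker r') : IsKoszulPlucker (r + r') := by
  obtain ⟨s, t, hs, ht, hr⟩ := h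
  obtain ⟨s', t', hs', ht', hr'⟩ := h'
  refine ⟨s + s', t + t', by simp [hs, hs'], by simp [ht, ht'], fun j => ?_⟩
  rw [Pi.add_apply, hr, hr', add_add_add_comm, ← Finset.sum_add_distrib, ← Finset.sum_add_distrib]
  congr 1
  · exact Finset.sum_congr rfl fun _ _ => by simp only [Pi.add_apply]; ring
  · simp only [← Finset.sum_add_distrib, Pi.add_apply]
    exact Finset.sum_congr rfl fun _ _ => Finset.sum_congr rfl fun _ _ => by ring

theorem isKoszulPlucker_sum {α : Type*} (S : Finset α) (r : α → ι → MvPolynomial (ι ⊕ ι) F)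
    (h : ∀ m ∈ S, IsKoszulPlucker (r m)) : IsKoszulPlucker (∑ m ∈ S, r m) :=
  Finset.sum_induction _ _ (fun _ _ => IsKoszulPlucker.add) isKoszulPlucker_zero h

variable [DecidableEq ι] [CharZero F]

/-- Polynomials killed by the square of the raising operator are combinations of `1, y₁, …, y_d`
with constants as coefficients, in the bihomogeneous case. -/
theorem exists_eq_add_sum_of_isWeightedHomogeneous {p q : ℤ} {f : MvPolynomial (ι ⊕ ι) F}
    (hf : IsWeightedHomogeneous bidegree f (p, q)) (h : raise (raise f) = 0) :
    ∃ (r₀ : MvPolynomial (ι ⊕ ι) F) (r : ι → MvPolynomial (ι ⊕ ι) F), raise r₀ = 0 ∧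
      (∀ j, raise (r j) = 0) ∧ f = r₀ + ∑ j, X (Sum.inr j) * r j := by
  by_cases hp : p < 0
  · exact ⟨0, 0, by simp, by simp, by simp [eq_zero_of_bidegree_neg hf (Or.inl hp)]⟩
  by_cases hpq : p + 2 ≤ q
  · exact ⟨0, 0, by simp, by simp, by simp [eq_zero_of_raise_raise_eq_zero hf hpq h]⟩
  have hr := isWeightedHomogeneous_raise hf
  set c : F := (((p + 1 : ℤ) : F) - ((q - 1 : ℤ) : F)) * (((p + 1 : ℤ) : F) + 1) with hc
  have hc0 : c ≠ 0 := by
    have : ((p + 1) - (q - 1)) * (p + 1 + 1) ≠ 0 := mul_ne_zero (by lia) (by lia)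
    rw [hc]
    exact_mod_cast this
  have h1 := sum_X_mul_contract hr h
  rw [← hc] at h1
  set r : ι → MvPolynomial (ι ⊕ ι) F := fun j => C c⁻¹ *
    contract (((p + 1 : ℤ) : F) - ((q - 1 : ℤ) : F) + 1) j (raise f) with hr_def
  have hr0 : ∀ j, raise (r j) = 0 := fun j => by
    rw [hr_def, derivation_map_C_mul, raise_contract hr h, mul_zero]
  refine ⟨f - ∑ j, X (Sum.inr j) * r j, r, ?_, hr0, by ring⟩
  simp only [map_sub, map_sum, Derivation.leibniz, hr0, raise_X_inr, smul_eq_mul, mul_zero,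
    zero_add]
  simp only [hr_def, mul_comm _ (X _), mul_left_comm (X _) (C _), ← Finset.mul_sum, h1]
  rw [← mul_assoc, ← C_mul, inv_mul_cancel₀ hc0, C_1, one_mul, sub_self]

theorem exists_eq_add_sum_of_raise_raise_eq_zero {f : MvPolynomial (ι ⊕ ι) F}
    (h : raise (raise f) = 0) :
    ∃ (r₀ : MvPolynomial (ι ⊕ ι) F) (r : ι → MvPolynomial (ι ⊕ ι) F), raise r₀ = 0 ∧
      (∀ j, raise (r j) = 0) ∧ f = r₀ + ∑ j, X (Sum.inr j) * r j := by
  obtain ⟨S, hS⟩ := exists_finset_sum_component bidegree (fun _ : Unit => f)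
  have hm : ∀ m : ℤ × ℤ, raise (raise (weightedHomogeneousComponent bidegree m f)) = 0 := by
    intro m
    rw [← Prod.mk.eta (p := m), ← component_raise]
    exact component_raise_eq_zero h _
  choose r₀ r h₀ hr heq using fun m => exists_eq_add_sum_of_isWeightedHomogeneous
    (weightedHomogeneousComponent_isWeightedHomogeneous (w := bidegree) m f) (hm m)
  refine ⟨∑ m ∈ S, r₀ m, fun j => ∑ m ∈ S, r m j, by simp [h₀], by simp [hr], ?_⟩
  rw [← hS (), Finset.sum_congr rfl fun m _ => heq m, Finset.sum_add_distrib, Finset.sum_comm]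
  simp only [Finset.mul_sum]

theorem isKoszulPlucker_of_pos {p q : ℤ} (hq : 0 ≤ q) (hpq : q < p)
    {r : ι → MvPolynomial (ι ⊕ ι) F}
    (hr : ∀ j, IsWeightedHomogeneous bidegree (r j) (p, q)) (h : ∀ j, raise (r j) = 0)
    (hs : ∑ k, X (Sum.inl k) * r k = 0) : IsKoszulPlucker r := by
  set c : F := (p : F) - q + 1 with hc
  set v := ∑ k, X (Sum.inr k) * r k with hv
  have hvh : IsWeightedHomogeneous bidegree v (p, q + 1) :=
    IsWeightedHomogeneous.sum _ _ _ fun i _ => by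
      have := (isWeightedHomogeneous_X F bidegree (Sum.inr i)).mul (hr i)
      simpa [bidegree, add_comm] using this
  have hv0 : raise v = 0 := by
    simp only [hv, map_sum, Derivation.leibniz, h, raise_X_inr, smul_eq_mul, mul_zero,
      zero_add, mul_comm _ (X _), hs]
  have hdh : ∀ j, IsWeightedHomogeneous bidegree (pderiv (Sum.inr j) v) (p, q) := fun j => by
    simpa using isWeightedHomogeneous_pderiv_inr hvh j
  have hd0 : ∀ j, raise (pderiv (Sum.inr j) v) = 0 := fun j => by
    rw [← pderiv_inr_raise, hv0, map_zero]
  have h1 := sum_X_mul_contract_sub hr h hs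
  have h2 := sum_X_mul_contract_sub hdh hd0 (by rw [← polarization_apply]; exact hv0)
  have h3 := eulerY_eq hvh
  rw [polarization_apply] at h3
  simp only [h3, pderiv_C_mul, ← hc, ← hv] at h1 h2
  set e : F := ((p : F) - q) * (p + 2) with he
  have he0 : e ≠ 0 := by
    have : (p - q) * (p + 2) ≠ 0 := mul_ne_zero (by lia) (by lia)
    rw [he]
    exact_mod_cast this
  have he1 : e + ((q : F) + 1) ≠ 0 := by
    have h4 : 0 < (p - q) * (p + 2) := mul_pos (by lia) (by lia)
    have : (p - q) * (p + 2) + (q + 1) ≠ 0 := by lia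
    rw [he]
    exact_mod_cast this
  refine ⟨fun j k => C e⁻¹ * contract c k (r j) -
    C (e⁻¹ * (e + (q + 1))⁻¹) * contract c k (pderiv (Sum.inr j) v), 0, fun j k => ?_, by simp,
    fun j => ?_⟩
  · simp only [map_sub, derivation_map_C_mul]
    rw [raise_contract (hr j) (h j), raise_contract (hdh j) (hd0 j)]
    simp
  · have e1 : (C e⁻¹ : MvPolynomial (ι ⊕ ι) F) * C e = 1 := by
      rw [← C_mul, inv_mul_cancel₀ he0, C_1]
    have e2 : (C (e + (q + 1))⁻¹ : MvPolynomial (ι ⊕ ι) F) * C (e + (q + 1)) = 1 := by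
      rw [← C_mul, inv_mul_cancel₀ he1, C_1]
    have h5 : ∑ k, X (Sum.inl k) * ((C e⁻¹ * contract c k (r j) -
        C (e⁻¹ * (e + (q + 1))⁻¹) * contract c k (pderiv (Sum.inr j) v)) -
        (C e⁻¹ * contract c j (r k) -
        C (e⁻¹ * (e + (q + 1))⁻¹) * contract c j (pderiv (Sum.inr k) v))) =
        C e⁻¹ * (∑ k, X (Sum.inl k) * (contract c k (r j) - contract c j (r k))) -
        C (e⁻¹ * (e + (q + 1))⁻¹) * ∑ k, X (Sum.inl k) *
          (contract c k (pderiv (Sum.inr j) v) - contract c j (pderiv (Sum.inr k) v)) := by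
      rw [Finset.mul_sum, Finset.mul_sum, ← Finset.sum_sub_distrib]
      exact Finset.sum_congr rfl fun _ _ => by ring
    simp only [h5, h1, h2, Pi.zero_apply, sub_self, add_zero, mul_zero, Finset.sum_const_zero]
    simp only [C_mul, C_add, Int.cast_add, Int.cast_one] at e2 ⊢
    linear_combination -(r j) * e1 + C e⁻¹ * pderiv (Sum.inr j) v * e2

end BinaryPolarization

namespace BinaryPolarization
variable {F : Type*} [Field F] {ι : Type*} [Fintype ι]

omit [Fintype ι] in
/-- Cayley's operator `∂²/∂xₐ∂y_b - ∂²/∂x_b∂yₐ`. -/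
def cayley (a b : ι) (f : MvPolynomial (ι ⊕ ι) F) : MvPolynomial (ι ⊕ ι) F :=
  pderiv (Sum.inl a) (pderiv (Sum.inr b) f) - pderiv (Sum.inl b) (pderiv (Sum.inr a) f)

/-- The cyclic sum `Ω_{ab} r_c + Ω_{bc} r_a + Ω_{ca} r_b` of Cayley's operators. -/
def cayleyCyclic (r : ι → MvPolynomial (ι ⊕ ι) F) (a b c : ι) : MvPolynomial (ι ⊕ ι) F :=
  cayley a b (r c) + cayley b c (r a) + cayley c a (r b)

variable [DecidableEq ι]

theorem raise_cayley (a b : ι) {f : MvPolynomial (ι ⊕ ι) F} (h : raise f = 0) :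
    raise (cayley a b f) = 0 := by
  have h1 : ∀ k, raise (pderiv (Sum.inr k) f) = 0 := fun k => by
    rw [← pderiv_inr_raise, h, map_zero]
  have h2 : ∀ j k, raise (pderiv (Sum.inl j) (pderiv (Sum.inr k) f)) =
      -pderiv (Sum.inr j) (pderiv (Sum.inr k) f) := fun j k => by
    have := pderiv_inl_raise j (pderiv (Sum.inr k) f)
    rw [h1, map_zero] at this
    linear_combination -this
  rw [cayley, map_sub, h2, h2, pderiv_comm (Sum.inr a)]
  ring

theorem sum_cayley_self {p : ℤ} {f : MvPolynomial (ι ⊕ ι) F}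
    (hf : IsWeightedHomogeneous bidegree f (p, p)) (h : raise f = 0) :
    ∑ i, ∑ k, X (Sum.inl k) * X (Sum.inr i) * cayley k i f = C ((p : F) * (p + 1)) * f := by
  have key : ∀ i, ∑ k, X (Sum.inl k) * X (Sum.inr i) * cayley k i f =
      C ((p : F) + 1) * (X (Sum.inr i) * pderiv (Sum.inr i) f) := fun i => by
    have h1 := eulerX_eq (isWeightedHomogeneous_pderiv_inr hf i)
    have h2 := pderiv_inl_raise i f
    rw [h, map_zero] at h2
    rw [polarization_apply] at h1 h2
    simp only [← pderiv_comm (Sum.inl i)] at h2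
    simp only [cayley, mul_sub, Finset.sum_sub_distrib, mul_assoc,
      mul_left_comm _ (X (Sum.inr i)), ← Finset.mul_sum]
    rw [h1, C_add, C_1]
    linear_combination X (Sum.inr i) * h2
  have h3 := eulerY_eq hf
  rw [polarization_apply] at h3
  rw [Finset.sum_congr rfl fun i _ => key i, ← Finset.mul_sum, h3, ← mul_assoc, ← C_mul,
    mul_comm (p : F)]

variable [CharZero F]

theorem sum_cayleyCyclic {p : ℤ} {r : ι → MvPolynomial (ι ⊕ ι) F}
    (hr : ∀ j, IsWeightedHomogeneous bidegree (r j) (p, p)) (h : ∀ j, raise (r j) = 0)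
    (hs : ∑ k, X (Sum.inl k) * r k = 0) (j : ι) :
    ∑ i, ∑ k, X (Sum.inl k) * X (Sum.inr i) * cayleyCyclic r i j k =
      C (((p : F) + 1) * (p + 2)) * r j := by
  have hl : ∀ j, lower (r j) = 0 := fun j => lower_eq_zero_of_raise_eq_zero (hr j) (h j)
  have hs' : ∑ k, X (Sum.inr k) * r k = 0 := by
    have := sum_X_mul_lower r
    simpa [hl, hs] using this
  have e1 := congrArg (pderiv (Sum.inl j)) hs
  have e2 := congrArg (pderiv (Sum.inr j)) hs'
  simp only [map_sum, pderiv_mul, pderiv_X, Pi.single_apply, Sum.inl.injEq, Sum.inr.injEq,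
    ite_mul, one_mul, zero_mul, Finset.sum_add_distrib,
    map_zero, Finset.sum_ite_eq', Finset.mem_univ, if_true] at e1 e2
  have A : ∑ i, ∑ k, X (Sum.inl k) * X (Sum.inr i) * cayley i j (r k) = C ((p : F) + 1) * r j := by
    rw [Finset.sum_comm]
    have key : ∀ k, ∑ i, X (Sum.inl k) * X (Sum.inr i) * cayley i j (r k) =
        -(C ((p : F) + 1)) * (X (Sum.inl k) * pderiv (Sum.inl j) (r k)) := fun k => by
      have h1 := eulerY_eq (isWeightedHomogeneous_pderiv_inl (hr k) j)
      have h2 := pderiv_inr_lower j (r k)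
      rw [hl, map_zero] at h2
      rw [polarization_apply] at h1 h2
      simp only [← pderiv_comm (Sum.inl j)] at h1
      simp only [cayley, mul_sub, Finset.sum_sub_distrib, mul_assoc, ← Finset.mul_sum]
      rw [h1, C_add, C_1]
      linear_combination -X (Sum.inl k) * h2
    rw [Finset.sum_congr rfl fun k _ => key k, ← Finset.mul_sum]
    linear_combination -C ((p : F) + 1) * e1
  have B : ∑ i, ∑ k, X (Sum.inl k) * X (Sum.inr i) * cayley j k (r i) = C ((p : F) + 1) * r j := by
    have key : ∀ i, ∑ k, X (Sum.inl k) * X (Sum.inr i) * cayley j k (r i) =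
        -(C ((p : F) + 1)) * (X (Sum.inr i) * pderiv (Sum.inr j) (r i)) := fun i => by
      have h1 := eulerX_eq (isWeightedHomogeneous_pderiv_inr (hr i) j)
      have h2 := pderiv_inl_raise j (r i)
      rw [h, map_zero] at h2
      rw [polarization_apply] at h1 h2
      simp only [← pderiv_comm (Sum.inl j)] at h2
      simp only [cayley, mul_sub, Finset.sum_sub_distrib, mul_assoc,
        mul_left_comm _ (X (Sum.inr i)), ← Finset.mul_sum]
      rw [h1, C_add, C_1]
      linear_combination -X (Sum.inr i) * h2
    rw [Finset.sum_congr rfl fun k _ => key k, ← Finset.mul_sum]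
    linear_combination -C ((p : F) + 1) * e2
  simp only [cayleyCyclic, mul_add, Finset.sum_add_distrib]
  rw [A, B, sum_cayley_self (hr j) (h j), ← add_mul, ← add_mul, ← C_add, ← C_add]
  congr 2
  ring

theorem isKoszulPlucker_of_eq {p : ℤ} (hp : 0 ≤ p) {r : ι → MvPolynomial (ι ⊕ ι) F}
    (hr : ∀ j, IsWeightedHomogeneous bidegree (r j) (p, p)) (h : ∀ j, raise (r j) = 0)
    (hs : ∑ k, X (Sum.inl k) * r k = 0) : IsKoszulPlucker r := by
  set N : F := ((p : F) + 1) * (p + 2) with hN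
  have hN0 : 6 * N ≠ 0 := by
    have : 6 * ((p + 1) * (p + 2)) ≠ 0 :=
      mul_ne_zero (by norm_num) (mul_ne_zero (by lia) (by lia))
    rw [hN]
    exact_mod_cast this
  have h1 := sum_cayleyCyclic hr h hs
  rw [← hN] at h1
  refine ⟨0, fun a b c => C (6 * N)⁻¹ * cayleyCyclic r a b c, by simp, fun a b c => ?_,
    fun j => ?_⟩
  · rw [derivation_map_C_mul, cayleyCyclic, map_add, map_add, raise_cayley _ _ (h _),
      raise_cayley _ _ (h _), raise_cayley _ _ (h _)]
    simp
  · have h2 : ∀ b c, minor b c * (C (6 * N)⁻¹ * cayleyCyclic r j b c -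
        C (6 * N)⁻¹ * cayleyCyclic r b j c + C (6 * N)⁻¹ * cayleyCyclic r b c j) =
        C (6 * N)⁻¹ * 3 * (X (Sum.inl b) * X (Sum.inr c) * cayleyCyclic r c j b) +
        C (6 * N)⁻¹ * 3 * (X (Sum.inl c) * X (Sum.inr b) * cayleyCyclic r b j c) := by
      intro b c
      simp only [cayleyCyclic, cayley, minor]
      ring
    simp only [h2, Finset.sum_add_distrib, ← Finset.mul_sum, h1]
    rw [Finset.sum_comm, h1]
    have e : (C (6 * N)⁻¹ : MvPolynomial (ι ⊕ ι) F) * (6 * C N) = 1 := by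
      have h6 : (6 : MvPolynomial (ι ⊕ ι) F) = C 6 := (map_ofNat C 6).symm
      rw [h6, ← C_mul, ← C_mul, inv_mul_cancel₀ hN0, C_1]
    simp only [Pi.zero_apply, sub_self, mul_zero, Finset.sum_const_zero, zero_add]
    linear_combination -(r j) * e

/-- The syzygies of `x₁, …, x_d` over the constants of the raising operator are generated by the
Koszul and the Plücker syzygies. -/
theorem isKoszulPlucker_of_sum_eq_zero {r : ι → MvPolynomial (ι ⊕ ι) F}
    (h : ∀ j, raise (r j) = 0) (hs : ∑ k, X (Sum.inl k) * r k = 0) : IsKoszulPlucker r := by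
  obtain ⟨S, hS⟩ := exists_finset_sum_component bidegree r
  have hr : r = ∑ m ∈ S, fun j => weightedHomogeneousComponent bidegree m (r j) := by
    ext1 j
    rw [Finset.sum_apply, hS]
  rw [hr]
  refine isKoszulPlucker_sum S _ fun m _ => ?_
  have hm : ∀ j, IsWeightedHomogeneous bidegree
      (weightedHomogeneousComponent bidegree m (r j)) (m.1, m.2) := fun j =>
    weightedHomogeneousComponent_isWeightedHomogeneous m (r j)
  have hm0 : ∀ j, raise (weightedHomogeneousComponent bidegree m (r j)) = 0 := fun j =>
    component_raise_eq_zero (h j) m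
  have hms : ∑ k, X (Sum.inl k) * weightedHomogeneousComponent bidegree m (r k) = 0 := by
    simp only [← component_X_inl_mul, ← map_sum, hs, map_zero]
  by_cases hneg : m.2 < 0 ∨ m.1 < m.2
  · have h0 : (fun j => weightedHomogeneousComponent bidegree m (r j)) = 0 := by
      ext1 j
      rcases hneg with hneg | hneg
      · exact eq_zero_of_bidegree_neg (hm j) (Or.inr hneg)
      · exact eq_zero_of_raise_eq_zero (hm j) hneg (hm0 j)
    rw [h0]
    exact isKoszulPlucker_zero
  · push Not at hneg
    rcases hneg.2.eq_or_lt with heq | hlt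
    · exact isKoszulPlucker_of_eq hneg.1 (fun j => by simpa [← heq] using hm j) hm0 hms
    · exact isKoszulPlucker_of_pos hneg.1 hlt hm hm0 hms

omit [CharZero F] in
theorem raise_minor (p q : ι) : raise (minor p q : MvPolynomial (ι ⊕ ι) F) = 0 := by
  simp only [minor, map_sub, Derivation.leibniz, raise_X_inl, raise_X_inr, smul_eq_mul]
  ring

end BinaryPolarization

namespace KoszulPlucker

variable {R : Type*} [CommRing R] {ι : Type*}

/-- The relation `u_{jk} Aᵢ - x_j W_{ik} + x_k W_{ij}`. -/
def koszulRelation (u : ι → ι → R) (x : ι → R) (i j k : ι) : (ι ⊕ ι × ι) →₀ R :=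
  u j k • Finsupp.single (Sum.inl i) 1 - x j • Finsupp.single (Sum.inr (i, k)) 1
    + x k • Finsupp.single (Sum.inr (i, j)) 1

/-- The relation `u_{kl} W_{ij} - u_{jl} W_{ik} + u_{jk} W_{il}`. -/
def pluckerRelation (u : ι → ι → R) (i j k l : ι) : (ι ⊕ ι × ι) →₀ R :=
  u k l • Finsupp.single (Sum.inr (i, j)) 1 - u j l • Finsupp.single (Sum.inr (i, k)) 1
    + u j k • Finsupp.single (Sum.inr (i, l)) 1

variable {u : ι → ι → R} {x : ι → R}

theorem linearCombination_koszulRelation {M : Type*} [AddCommGroup M] [Module R M]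
    (v : ι ⊕ ι × ι → M) (i j k : ι) :
    Finsupp.linearCombination R v (koszulRelation u x i j k) =
      u j k • v (Sum.inl i) - x j • v (Sum.inr (i, k)) + x k • v (Sum.inr (i, j)) := by
  simp [koszulRelation]

theorem linearCombination_pluckerRelation {M : Type*} [AddCommGroup M] [Module R M]
    (v : ι ⊕ ι × ι → M) (i j k l : ι) :
    Finsupp.linearCombination R v (pluckerRelation u i j k l) =
      u k l • v (Sum.inr (i, j)) - u j l • v (Sum.inr (i, k)) + u j k • v (Sum.inr (i, l)) := by
  simp [pluckerRelation]

theorem koszulRelation_mem [LinearOrder ι] {N : Submodule R ((ι ⊕ ι × ι) →₀ R)}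
    (hu : ∀ j k, u k j = -u j k) (hu₀ : ∀ j, u j j = 0)
    (hN : ∀ i j k, j < k → koszulRelation u x i j k ∈ N) (i j k : ι) :
    koszulRelation u x i j k ∈ N := by
  rcases lt_trichotomy j k with h | rfl | h
  · exact hN i j k h
  · have h1 : koszulRelation u x i j j = 0 := by
      simp [koszulRelation, hu₀]
    rw [h1]
    exact N.zero_mem
  · have h1 : koszulRelation u x i j k = -koszulRelation u x i k j := by
      simp only [koszulRelation, hu k j, neg_smul]
      abel
    rw [h1]
    exact N.neg_mem (hN i k j h)

theorem pluckerRelation_mem [LinearOrder ι] {N : Submodule R ((ι ⊕ ι × ι) →₀ R)}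
    (hu : ∀ j k, u k j = -u j k) (hu₀ : ∀ j, u j j = 0)
    (hN : ∀ i j k l, j < k → k < l → pluckerRelation u i j k l ∈ N) (i j k l : ι) :
    pluckerRelation u i j k l ∈ N := by
  have swap₁ : ∀ j k l, pluckerRelation u i j k l = -pluckerRelation u i k j l :=
    fun j k l => by
      simp only [pluckerRelation, hu k j, neg_smul]
      abel
  have swap₂ : ∀ j k l, pluckerRelation u i j k l = -pluckerRelation u i j l k :=
    fun j k l => by
      simp only [pluckerRelation, hu l k, neg_smul]
      abel
  have self₁ : ∀ j l, pluckerRelation u i j j l = 0 := fun j l => by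
    simp [pluckerRelation, hu₀]
  have self₂ : ∀ j k, pluckerRelation u i j k k = 0 := fun j k => by
    simp [pluckerRelation, hu₀]
  have key : ∀ j k l, j < k → pluckerRelation u i j k l ∈ N := by
    intro j k l hjk
    rcases lt_trichotomy k l with h | rfl | h
    · exact hN i j k l hjk h
    · rw [self₂]
      exact N.zero_mem
    · rw [swap₂]
      refine N.neg_mem ?_
      rcases lt_trichotomy j l with h' | rfl | h'
      · exact hN i j l k h' h
      · rw [self₁]
        exact N.zero_mem
      · rw [swap₁]
        exact N.neg_mem (hN i l j k h' hjk)
  rcases lt_trichotomy j k with h | rfl | h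
  · exact key j k l h
  · rw [self₁]
    exact N.zero_mem
  · rw [swap₁]
    exact N.neg_mem (key k j l h)

variable [Fintype ι]

theorem sum_koszulRelation_apply [DecidableEq ι] (s : ι → ι → R) (i i' j' : ι) :
    (∑ j, ∑ k, s j k • koszulRelation u x i j k) (Sum.inr (i', j')) =
      if i = i' then ∑ k, x k * (s j' k - s k j') else 0 := by
  simp only [Finsupp.finsetSum_apply, koszulRelation, Finsupp.smul_apply, Finsupp.add_apply,
    Finsupp.sub_apply, Finsupp.single_apply, reduceCtorEq, if_false, Sum.inr.injEq, Prod.mk.injEq,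
    smul_eq_mul, mul_zero, zero_sub]
  split_ifs with h
  · simp only [h, true_and, mul_ite, mul_one, mul_zero, mul_add, mul_neg, mul_sub,
      Finset.sum_add_distrib, Finset.sum_sub_distrib, Finset.sum_neg_distrib, Finset.sum_ite_eq',
      Finset.mem_univ, if_true]
    rw [Finset.sum_comm (f := fun j k => if j = j' then s j k * x k else 0)]
    simp only [Finset.sum_ite_eq', Finset.mem_univ, if_true, mul_comm (x _)]
    ring
  · simp [h]

theorem sum_pluckerRelation_apply [DecidableEq ι] (t : ι → ι → ι → R) (i i' j' : ι) :
    (∑ a, ∑ b, ∑ c, t a b c • pluckerRelation u i a b c) (Sum.inr (i', j')) =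
      if i = i' then ∑ b, ∑ c, u b c * (t j' b c - t b j' c + t b c j') else 0 := by
  simp only [Finsupp.finsetSum_apply, pluckerRelation, Finsupp.smul_apply, Finsupp.add_apply,
    Finsupp.sub_apply, Finsupp.single_apply, Sum.inr.injEq, Prod.mk.injEq, smul_eq_mul]
  split_ifs with h
  · have h1 : ∀ a b c, t a b c * (u b c * (if a = j' then 1 else 0)
        - u a c * (if b = j' then 1 else 0) + u a b * (if c = j' then 1 else 0)) =
        (if a = j' then t a b c * u b c else 0) - (if b = j' then t a b c * u a c else 0) +
        (if c = j' then t a b c * u a b else 0) := fun a b c => by split_ifs <;> ring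
    have h2 : ∑ a, ∑ b, ∑ c, (if a = j' then t a b c * u b c else 0) =
        ∑ b, ∑ c, t j' b c * u b c := by
      rw [Finset.sum_eq_single j' (fun a _ ha => by simp [ha]) (by simp)]
      simp
    have h3 : ∑ a, ∑ b, ∑ c, (if b = j' then t a b c * u a c else 0) =
        ∑ b, ∑ c, t b j' c * u b c := Finset.sum_congr rfl fun a _ => by
      rw [Finset.sum_eq_single j' (fun a _ ha => by simp [ha]) (by simp)]
      simp
    simp only [h, true_and, h1, Finset.sum_add_distrib, Finset.sum_sub_distrib, h2, h3,
      Finset.sum_ite_eq', Finset.mem_univ, if_true]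
    simp only [mul_comm (u _ _), add_mul, sub_mul, Finset.sum_add_distrib,
      Finset.sum_sub_distrib]
  · simp [h]

theorem ker_eq_span {M : Type*} [AddCommGroup M] [Module R M] [LinearOrder ι]
    {φ : ((ι ⊕ ι × ι) →₀ R) →ₗ[R] M} (hu : ∀ j k, u k j = -u j k) (hu₀ : ∀ j, u j j = 0)
    (hK : ∀ i j k, φ (koszulRelation u x i j k) = 0)
    (hP : ∀ i j k l, φ (pluckerRelation u i j k l) = 0)
    (hφ : ∀ m, φ m = 0 → (∀ p, m (Sum.inr p) = 0) → m = 0)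
    (hsyz : ∀ m, φ m = 0 → ∀ i, ∃ (s : ι → ι → R) (t : ι → ι → ι → R), ∀ j,
      m (Sum.inr (i, j)) = ∑ k, x k * (s j k - s k j) +
        ∑ b, ∑ c, u b c * (t j b c - t b j c + t b c j)) :
    LinearMap.ker φ = Submodule.span R
      ({m | ∃ i j k, j < k ∧ m = koszulRelation u x i j k} ∪
        {m | ∃ i j k l, j < k ∧ k < l ∧ m = pluckerRelation u i j k l}) := by
  apply le_antisymm
  · intro m hm
    rw [LinearMap.mem_ker] at hm
    choose s t hst using hsyz m hm
    set N := Submodule.span R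
      ({m | ∃ i j k, j < k ∧ m = koszulRelation u x i j k} ∪
        {m | ∃ i j k l, j < k ∧ k < l ∧ m = pluckerRelation u i j k l})
    have hKN := koszulRelation_mem (N := N) (x := x) hu hu₀ fun i j k h =>
      Submodule.subset_span (Or.inl ⟨i, j, k, h, rfl⟩)
    have hPN := pluckerRelation_mem (N := N) hu hu₀ fun i j k l h h' =>
      Submodule.subset_span (Or.inr ⟨i, j, k, l, h, h', rfl⟩)
    set D : (ι ⊕ ι × ι) →₀ R := ∑ i, ((∑ j, ∑ k, s i j k • koszulRelation u x i j k) +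
      ∑ a, ∑ b, ∑ c, t i a b c • pluckerRelation u i a b c) with hD
    have hDN : D ∈ N := by
      refine N.sum_mem fun i _ => N.add_mem ?_ ?_
      · exact N.sum_mem fun j _ => N.sum_mem fun k _ => N.smul_mem _ (hKN i j k)
      · exact N.sum_mem fun a _ => N.sum_mem fun b _ => N.sum_mem fun c _ =>
          N.smul_mem _ (hPN i a b c)
    have hDφ : φ D = 0 := by
      simp only [hD, map_sum, map_add, map_smul, hK, hP, smul_zero, Finset.sum_const_zero,
        add_zero]
    have hDr : ∀ p, (m - D) (Sum.inr p) = 0 := by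
      rintro ⟨i, j⟩
      rw [Finsupp.sub_apply, sub_eq_zero, hst, hD, Finsupp.finsetSum_apply]
      simp only [Finsupp.add_apply, sum_koszulRelation_apply, sum_pluckerRelation_apply]
      simp [Finset.sum_add_distrib]
    rwa [sub_eq_zero.mp (hφ (m - D) (by rw [map_sub, hm, hDφ, sub_zero]) hDr)]
  · rw [Submodule.span_le]
    rintro _ (⟨i, j, k, -, rfl⟩ | ⟨i, j, k, l, -, -, rfl⟩)
    · exact hK i j k
    · exact hP i j k l

end KoszulPlucker

open BinaryPolarization

section Transfer

variable {F : Type*} [Field F] {n : ℕ}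
  {δ : Derivation F (MvPolynomial (Var4 n) F) (MvPolynomial (Var4 n) F)}

theorem embXY_X_inl (i : Fin n) : embXY F n (X (Sum.inl i)) = xP F n i := rename_X _ _

theorem embXY_X_inr (i : Fin n) : embXY F n (X (Sum.inr i)) = yP F n i := rename_X _ _

theorem embXY_minor (p q : Fin n) : embXY F n (minor p q) = uP F n p q := by
  simp [minor, uP, embXY_X_inl, embXY_X_inr]

theorem pderiv_inl_embXY (k : Fin n ⊕ Fin n) (f : MvPolynomial (Fin n ⊕ Fin n) F) :
    pderiv (Sum.inl k) (embXY F n f) = 0 := by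
  classical
  refine pderiv_eq_zero_of_notMem_vars fun h => ?_
  have := vars_rename Sum.inr f h
  simp at this

/-- The element `∑ aᵢ Aᵢ + ∑ bᵢ Bᵢ` of `C_{2d}` with coordinates `A` and `B`. -/
def cmodOf (A B : Fin n → MvPolynomial (Fin n ⊕ Fin n) F) : MvPolynomial (Var4 n) F :=
  ∑ i, aP F n i * embXY F n (A i) + ∑ i, bP F n i * embXY F n (B i)

theorem eq_zero_of_cmodOf_eq_zero {A B : Fin n → MvPolynomial (Fin n ⊕ Fin n) F}
    (h : cmodOf A B = 0) : A = 0 ∧ B = 0 := by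
  have hinj : Function.Injective (embXY F n) := rename_injective _ Sum.inr_injective
  constructor <;> ext1 j <;> apply hinj
  · have := congrArg (pderiv (Sum.inl (Sum.inl j))) h
    simpa [cmodOf, pderiv_mul, pderiv_inl_embXY, aP, bP, pderiv_X, Pi.single_apply] using this
  · have := congrArg (pderiv (Sum.inl (Sum.inr j))) h
    simpa [cmodOf, pderiv_mul, pderiv_inl_embXY, aP, bP, pderiv_X, Pi.single_apply] using this

theorem derivation_embXY (hx : ∀ i : Fin n, δ (xP F n i) = 0)
    (hy : ∀ i : Fin n, δ (yP F n i) = xP F n i) (f : MvPolynomial (Fin n ⊕ Fin n) F) :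
    δ (embXY F n f) = embXY F n (raise f) := by
  induction f using MvPolynomial.induction_on with
  | C a =>
    rw [embXY, rename_C, derivation_C, derivation_C, map_zero]
  | add p q hp hq => simp only [map_add, hp, hq]
  | mul_X p k hp =>
    simp only [map_mul, Derivation.leibniz, smul_eq_mul, map_add, hp]
    rcases k with k | k
    · rw [embXY_X_inl, hx, raise_X_inl, map_zero]
    · rw [embXY_X_inr, hy, raise_X_inr, embXY_X_inl]

theorem derivation_cmodOf (ha : ∀ i : Fin n, δ (aP F n i) = 0)
    (hb : ∀ i : Fin n, δ (bP F n i) = aP F n i) (hx : ∀ i : Fin n, δ (xP F n i) = 0)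
    (hy : ∀ i : Fin n, δ (yP F n i) = xP F n i) (A B : Fin n → MvPolynomial (Fin n ⊕ Fin n) F) :
    δ (cmodOf A B) = cmodOf (fun i => raise (A i) + B i) (fun i => raise (B i)) := by
  simp only [cmodOf, map_add, map_sum, Derivation.leibniz, ha, hb, derivation_embXY hx hy,
    smul_eq_mul, mul_zero, mul_add, Finset.sum_add_distrib, add_zero]
  simp only [mul_comm (aP F n _)]
  ring

/-- The element of `R` given by a constant of the raising operator. -/
def toRconst (hx : ∀ i : Fin n, δ (xP F n i) = 0) (hy : ∀ i : Fin n, δ (yP F n i) = xP F n i)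
    (f : MvPolynomial (Fin n ⊕ Fin n) F) (hf : raise f = 0) : Rconst F n δ :=
  ⟨embXY F n f, ⟨f, rfl⟩, show δ (embXY F n f) = 0 by rw [derivation_embXY hx hy, hf, map_zero]⟩

theorem exists_embXY_eq (hx : ∀ i : Fin n, δ (xP F n i) = 0)
    (hy : ∀ i : Fin n, δ (yP F n i) = xP F n i) (r : Rconst F n δ) :
    ∃ f, raise f = 0 ∧ embXY F n f = r := by
  have hinj : Function.Injective (embXY F n) := rename_injective _ Sum.inr_injective
  obtain ⟨_, ⟨f, rfl⟩, hf⟩ := r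
  refine ⟨f, hinj ?_, rfl⟩
  have h : δ (embXY F n f) = 0 := hf
  rw [derivation_embXY hx hy] at h
  exact h.trans (map_zero _).symm

theorem phiMap_apply (m : (Fin n ⊕ Fin n × Fin n) →₀ Rconst F n δ) :
    phiMap F n δ m = ∑ i, (m (Sum.inl i) : MvPolynomial (Var4 n) F) * aP F n i +
      ∑ i, ∑ j, (m (Sum.inr (i, j)) : MvPolynomial (Var4 n) F) * wP F n i j := by
  rw [phiMap, Finsupp.linearCombination_apply, Finsupp.sum_fintype _ _ (by simp),
    Fintype.sum_sum_type, Fintype.sum_prod_type]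
  rfl

theorem phiMap_eq_cmodOf {m : (Fin n ⊕ Fin n × Fin n) →₀ Rconst F n δ}
    {f : Fin n → MvPolynomial (Fin n ⊕ Fin n) F}
    {g : Fin n → Fin n → MvPolynomial (Fin n ⊕ Fin n) F}
    (hf : ∀ i, embXY F n (f i) = m (Sum.inl i))
    (hg : ∀ i j, embXY F n (g i j) = m (Sum.inr (i, j))) :
    phiMap F n δ m = cmodOf (fun i => f i + ∑ j, X (Sum.inr j) * g i j)
      (fun i => -∑ j, X (Sum.inl j) * g i j) := by
  simp only [phiMap_apply, cmodOf, ← hf, ← hg, map_add, map_neg, map_sum, map_mul, embXY_X_inl,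
    embXY_X_inr, ← Finset.sum_add_distrib]
  refine Finset.sum_congr rfl fun i _ => ?_
  rw [mul_add, mul_neg, Finset.mul_sum, Finset.mul_sum, mul_comm, add_assoc, ← sub_eq_add_neg,
    ← Finset.sum_sub_distrib]
  congr 1
  refine Finset.sum_congr rfl fun j _ => ?_
  rw [wP]
  ring

theorem range_phiMap [CharZero F] (ha : ∀ i : Fin n, δ (aP F n i) = 0)
    (hb : ∀ i : Fin n, δ (bP F n i) = aP F n i) (hx : ∀ i : Fin n, δ (xP F n i) = 0)
    (hy : ∀ i : Fin n, δ (yP F n i) = xP F n i) :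
    (LinearMap.range (phiMap F n δ) : Set (MvPolynomial (Var4 n) F)) =
      {f : MvPolynomial (Var4 n) F | f ∈ Cmod F n ∧ δ f = 0} := by
  ext z
  constructor
  · rintro ⟨m, rfl⟩
    choose f hf0 hf using fun i => exists_embXY_eq hx hy (m (Sum.inl i))
    choose g hg0 hg using fun i j => exists_embXY_eq hx hy (m (Sum.inr (i, j)))
    rw [phiMap_eq_cmodOf hf hg]
    refine ⟨⟨_, _, rfl⟩, ?_⟩
    rw [derivation_cmodOf ha hb hx hy]
    simp only [map_add, map_neg, map_sum, Derivation.leibniz, hf0, hg0, raise_X_inl, raise_X_inr]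
    simp [cmodOf, mul_comm]
  · rintro ⟨⟨A, B, rfl⟩, h⟩
    change δ (cmodOf A B) = 0 at h
    rw [derivation_cmodOf ha hb hx hy] at h
    obtain ⟨h1, h2⟩ := eq_zero_of_cmodOf_eq_zero h
    have hB : ∀ i, B i = -raise (A i) := fun i => by
      have := congr_fun h1 i
      simp only [Pi.zero_apply] at this
      linear_combination this
    have hA : ∀ i, raise (raise (A i)) = 0 := fun i => by
      have := congr_fun h2 i
      simpa only [hB, map_neg, Pi.zero_apply, neg_eq_zero] using this
    choose f g hf hg hfg using fun i => exists_eq_add_sum_of_raise_raise_eq_zero (hA i)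
    refine ⟨Finsupp.equivFunOnFinite.symm (Sum.elim (fun i => toRconst hx hy (f i) (hf i))
      (fun p => toRconst hx hy (g p.1 p.2) (hg p.1 p.2))), ?_⟩
    rw [phiMap_eq_cmodOf (f := f) (g := g) (fun _ => rfl) (fun _ _ => rfl)]
    change _ = cmodOf A B
    congr 1
    · exact funext fun i => (hfg i).symm
    · ext1 i
      rw [hB, hfg]
      simp only [map_add, map_sum, Derivation.leibniz, hf, hg, raise_X_inr]
      simp [mul_comm]

theorem toRconst_minor_swap (hx : ∀ i : Fin n, δ (xP F n i) = 0)
    (hy : ∀ i : Fin n, δ (yP F n i) = xP F n i) (j k : Fin n) :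
    toRconst hx hy (minor k j) (raise_minor k j) = -toRconst hx hy (minor j k) (raise_minor j k) :=
  Subtype.ext <| by
    change embXY F n (minor k j) = -embXY F n (minor j k)
    rw [minor, minor, ← map_neg, neg_sub]

theorem toRconst_minor_self (hx : ∀ i : Fin n, δ (xP F n i) = 0)
    (hy : ∀ i : Fin n, δ (yP F n i) = xP F n i) (j : Fin n) :
    toRconst hx hy (minor j j) (raise_minor j j) = 0 :=
  Subtype.ext <| by
    change embXY F n (minor j j) = 0
    rw [minor, sub_self, map_zero]

theorem eq_zero_of_phiMap_eq_zero (hx : ∀ i : Fin n, δ (xP F n i) = 0)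
    (hy : ∀ i : Fin n, δ (yP F n i) = xP F n i)
    {m : (Fin n ⊕ Fin n × Fin n) →₀ Rconst F n δ} (hm : phiMap F n δ m = 0)
    (h : ∀ p, m (Sum.inr p) = 0) : m = 0 := by
  choose f hf0 hf using fun i => exists_embXY_eq hx hy (m (Sum.inl i))
  rw [phiMap_eq_cmodOf (g := 0) hf (fun i j => by rw [h]; exact map_zero _)] at hm
  have := (eq_zero_of_cmodOf_eq_zero hm).1
  ext1 (i | p)
  · have hi : f i = 0 := by simpa using congr_fun this i
    exact Subtype.ext (by rw [← hf, hi, map_zero]; rfl)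
  · exact h p

theorem toRconst_eq_sum {hx : ∀ i : Fin n, δ (xP F n i) = 0}
    {hy : ∀ i : Fin n, δ (yP F n i) = xP F n i}
    {s : Fin n → Fin n → MvPolynomial (Fin n ⊕ Fin n) F}
    {t : Fin n → Fin n → Fin n → MvPolynomial (Fin n ⊕ Fin n) F}
    (hs : ∀ j k, raise (s j k) = 0) (ht : ∀ a b c, raise (t a b c) = 0)
    {r : Rconst F n δ} {j : Fin n}
    (hr : embXY F n (∑ k, X (Sum.inl k) * (s j k - s k j) +
      ∑ b, ∑ c, minor b c * (t j b c - t b j c + t b c j)) = r) :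
    r = ∑ k, toRconst hx hy (X (Sum.inl k)) (raise_X_inl k) *
        (toRconst hx hy (s j k) (hs j k) - toRconst hx hy (s k j) (hs k j)) +
      ∑ b, ∑ c, toRconst hx hy (minor b c) (raise_minor b c) *
        (toRconst hx hy (t j b c) (ht j b c) - toRconst hx hy (t b j c) (ht b j c) +
          toRconst hx hy (t b c j) (ht b c j)) := by
  apply Subtype.ext
  rw [← hr]
  simp only [map_add, map_sum, map_mul, map_sub, AddMemClass.coe_add, MulMemClass.coe_mul,
    AddSubgroupClass.coe_sub, AddSubmonoidClass.coe_finsetSum]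
  rfl

theorem ker_phiMap [CharZero F] (hx : ∀ i : Fin n, δ (xP F n i) = 0)
    (hy : ∀ i : Fin n, δ (yP F n i) = xP F n i) :
    LinearMap.ker (phiMap F n δ) = Submodule.span (Rconst F n δ)
      ({m | ∃ i j k, j < k ∧ m = KoszulPlucker.koszulRelation
          (fun p q => toRconst hx hy (minor p q) (raise_minor p q))
          (fun p => toRconst hx hy (X (Sum.inl p)) (raise_X_inl p)) i j k} ∪
        {m | ∃ i j k l, j < k ∧ k < l ∧ m = KoszulPlucker.pluckerRelation
          (fun p q => toRconst hx hy (minor p q) (raise_minor p q)) i j k l}) := by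
  refine KoszulPlucker.ker_eq_span (φ := phiMap F n δ) (toRconst_minor_swap hx hy)
    (toRconst_minor_self hx hy) (fun i j k => ?_) (fun i j k l => ?_)
    (fun m => eq_zero_of_phiMap_eq_zero hx hy) (fun m hm i => ?_)
  · refine (KoszulPlucker.linearCombination_koszulRelation _ i j k).trans ?_
    change embXY F n (minor j k) * aP F n i - embXY F n (X (Sum.inl j)) * wP F n i k +
      embXY F n (X (Sum.inl k)) * wP F n i j = 0
    rw [embXY_minor, embXY_X_inl, embXY_X_inl, uP, wP, wP]
    ring
  · refine (KoszulPlucker.linearCombination_pluckerRelation _ i j k l).trans ?_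
    change embXY F n (minor k l) * wP F n i j - embXY F n (minor j l) * wP F n i k +
      embXY F n (minor j k) * wP F n i l = 0
    rw [embXY_minor, embXY_minor, embXY_minor, uP, uP, uP, wP, wP, wP]
    ring
  · choose f hf0 hf using fun i => exists_embXY_eq hx hy (m (Sum.inl i))
    choose g hg0 hg using fun i j => exists_embXY_eq hx hy (m (Sum.inr (i, j)))
    rw [phiMap_eq_cmodOf hf hg] at hm
    obtain ⟨s, t, hs, ht, hst⟩ := isKoszulPlucker_of_sum_eq_zero (hg0 i)
      (neg_eq_zero.mp (congr_fun (eq_zero_of_cmodOf_eq_zero hm).2 i))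
    exact ⟨fun j k => toRconst hx hy (s j k) (hs j k),
      fun a b c => toRconst hx hy (t a b c) (ht a b c),
      fun j => toRconst_eq_sum hs ht (hst j ▸ hg i j)⟩

end Transfer

/-- The defining relations of the `R`-module `C_{2d}^δ` with respect to the generators
`aᵢ`, `w_{pq}`: the image of `φ` is exactly `C_{2d}^δ` and the kernel of `φ` is the
`R`-submodule generated by the elements `u_{jk}·Aᵢ - x_j·W_{ik} + x_k·W_{ij}` (`j < k`)
and `u_{kl}·W_{ij} - u_{jl}·W_{ik} + u_{jk}·W_{il}` (`j < k < l`). -/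
theorem phiMap_range_and_ker (K : Type*) [Field K] [CharZero K] (d : ℕ) (hd : 2 ≤ d)
    (δ : Derivation K (MvPolynomial (Var4 d) K) (MvPolynomial (Var4 d) K))
    (ha : ∀ i : Fin d, δ (aP K d i) = 0)
    (hb : ∀ i : Fin d, δ (bP K d i) = aP K d i)
    (hx : ∀ i : Fin d, δ (xP K d i) = 0)
    (hy : ∀ i : Fin d, δ (yP K d i) = xP K d i) :
    ((LinearMap.range (phiMap K d δ) : Submodule ↥(Rconst K d δ) (MvPolynomial (Var4 d) K)) :
        Set (MvPolynomial (Var4 d) K)) =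
      {f : MvPolynomial (Var4 d) K | f ∈ Cmod K d ∧ δ f = 0} ∧
    LinearMap.ker (phiMap K d δ) =
      Submodule.span ↥(Rconst K d δ)
        ({m : (Fin d ⊕ Fin d × Fin d) →₀ ↥(Rconst K d δ) |
            ∃ i j k : Fin d, j < k ∧ ∃ uR xjR xkR : ↥(Rconst K d δ),
              (↑uR = uP K d j k) ∧ (↑xjR = xP K d j) ∧ (↑xkR = xP K d k) ∧
              m = uR • Finsupp.single (Sum.inl i) 1
                - xjR • Finsupp.single (Sum.inr (i, k)) 1
                + xkR • Finsupp.single (Sum.inr (i, j)) 1} ∪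
          {m : (Fin d ⊕ Fin d × Fin d) →₀ ↥(Rconst K d δ) |
            ∃ i j k l : Fin d, j < k ∧ k < l ∧ ∃ uklR ujlR ujkR : ↥(Rconst K d δ),
              (↑uklR = uP K d k l) ∧ (↑ujlR = uP K d j l) ∧ (↑ujkR = uP K d j k) ∧
              m = uklR • Finsupp.single (Sum.inr (i, j)) 1
                - ujlR • Finsupp.single (Sum.inr (i, k)) 1
                + ujkR • Finsupp.single (Sum.inr (i, l)) 1}) := by
  refine ⟨range_phiMap ha hb hx hy, (ker_phiMap hx hy).trans ?_⟩
  congr 2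
  · ext m
    constructor
    · rintro ⟨i, j, k, h, rfl⟩
      exact ⟨i, j, k, h, _, _, _, embXY_minor j k, embXY_X_inl j, embXY_X_inl k, rfl⟩
    · rintro ⟨i, j, k, h, uR, xjR, xkR, hu, hj, hk, rfl⟩
      obtain rfl : uR = toRconst hx hy (minor j k) (raise_minor j k) :=
        Subtype.ext (hu.trans (embXY_minor j k).symm)
      obtain rfl : xjR = toRconst hx hy (X (Sum.inl j)) (raise_X_inl j) :=
        Subtype.ext (hj.trans (embXY_X_inl j).symm)
      obtain rfl : xkR = toRconst hx hy (X (Sum.inl k)) (raise_X_inl k) :=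
        Subtype.ext (hk.trans (embXY_X_inl k).symm)
      exact ⟨i, j, k, h, rfl⟩
  · ext m
    constructor
    · rintro ⟨i, j, k, l, h, h', rfl⟩
      exact ⟨i, j, k, l, h, h', _, _, _, embXY_minor k l, embXY_minor j l, embXY_minor j k, rfl⟩
    · rintro ⟨i, j, k, l, h, h', uklR, ujlR, ujkR, hkl, hjl, hjk, rfl⟩
      obtain rfl : uklR = toRconst hx hy (minor k l) (raise_minor k l) :=
        Subtype.ext (hkl.trans (embXY_minor k l).symm)
      obtain rfl : ujlR = toRconst hx hy (minor j l) (raise_minor j l) :=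
        Subtype.ext (hjl.trans (embXY_minor j l).symm)
      obtain rfl : ujkR = toRconst hx hy (minor j k) (raise_minor j k) :=
        Subtype.ext (hjk.trans (embXY_minor j k).symm)
      exact ⟨i, j, k, l, h, h', rfl⟩

end
end

section
/- (Weitzenböck's theorem.) Let δ be a K-linear derivation of the polynomial algebra K[X_d] = K[x_1,…,x_d] such that δ(x_i) lies in the K-linear span of x_1,…,x_d for every i and the induced K-linear operator on the span of x_1,…,x_d is nilpotent (a Weitzenböck derivation). Then the algebra of constants K[X_d]^δ = {f ∈ K[X_d] : δ(f) = 0} is a finitely generated K-algebra: there is a finite subset S ⊆ K[X_d]^δ such that the K-subalgebra generated by S equals K[X_d]^δ. -/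
open MvPolynomial

namespace Weitzenboeck

/-- The `𝔰𝔩₂` commutation relations for three endomorphisms of a vector space
(all three are allowed to vanish). -/
structure Sl2Relations {K V : Type*} [Field K] [AddCommGroup V] [Module K V]
    (e f h : Module.End K V) : Prop where
  e_f : ∀ v, e (f v) = f (e v) + h v
  h_e : ∀ v, h (e v) = e (h v) + (2 : K) • e v
  h_f : ∀ v, h (f v) = f (h v) - (2 : K) • f v

namespace Sl2Relations

variable {K V : Type*} [Field K] [AddCommGroup V] [Module K V] {e f h : Module.End K V}

theorem symm (t : Sl2Relations e f h) : Sl2Relations f e (-h) where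
  e_f v := by simp [t.e_f]
  h_e v := by simp [t.h_f]; abel
  h_f v := by simp [t.h_e]; abel

theorem h_e_pow (t : Sl2Relations e f h) {v : V} {n : K} (hv : h v = n • v) (j : ℕ) :
    h ((e ^ j) v) = (n + 2 * j) • (e ^ j) v := by
  induction j with
  | zero => simp [hv]
  | succ j ih =>
    rw [pow_succ', Module.End.mul_apply, t.h_e, ih, map_smul, ← add_smul]
    congr 1; push_cast; ring

theorem e_pow_f (t : Sl2Relations e f h) {v : V} {n : K} (hv : h v = n • v) (j : ℕ) :
    (e ^ (j + 1)) (f v) = f ((e ^ (j + 1)) v) + ((j + 1) * (n + j) : K) • (e ^ j) v := by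
  induction j with
  | zero => simp [t.e_f, hv]
  | succ j ih =>
    rw [pow_succ', Module.End.mul_apply, ih, map_add, t.e_f, t.h_e_pow hv, map_smul,
      ← Module.End.mul_apply e (e ^ j), ← Module.End.mul_apply e (e ^ (j + 1)), ← pow_succ',
      ← pow_succ', add_assoc, ← add_smul]
    congr 2; push_cast; ring

theorem e_f_pow (t : Sl2Relations e f h) {v : V} {n : K} (hv : h v = n • v) (he : e v = 0)
    (j : ℕ) : e ((f ^ (j + 1)) v) = ((j + 1) * (n - j) : K) • (f ^ j) v := by
  have := t.symm.e_pow_f (v := v) (n := -n) (by simp [hv]) j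
  rw [he, map_zero] at this
  rw [eq_neg_of_add_eq_zero_left this.symm, ← neg_smul]
  congr 1; ring

theorem eq_zero_of_e_f_eq_zero [CharZero K] (t : Sl2Relations e f h) {v : V} {n : ℕ} (hn : n ≠ 0)
    (hv : h v = (n : K) • v) (hef : e (f v) = 0) {k : ℕ} (hk : (e ^ k) v = 0) : v = 0 := by
  induction k with
  | zero => simpa using hk
  | succ k ih =>
    refine ih ?_
    have := t.e_pow_f hv k
    rw [hk, pow_succ, Module.End.mul_apply, hef, map_zero, map_zero, zero_add] at this
    refine (smul_eq_zero.1 this.symm).resolve_left ?_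
    have : n + k ≠ 0 := by omega
    exact_mod_cast mul_ne_zero k.succ_ne_zero this

theorem exists_natCast_weight [CharZero K] (t : Sl2Relations e f h) {v : V} {n : K}
    (hv : h v = n • v) (he : e v = 0) (hv0 : v ≠ 0) (hf : ∃ k, (f ^ k) v = 0) :
    ∃ k : ℕ, n = k ∧ (f ^ (k + 1)) v = 0 := by
  classical
  obtain ⟨k, hk⟩ : ∃ k, Nat.find hf = k + 1 :=
    Nat.exists_eq_succ_of_ne_zero fun h0 ↦ hv0 (by simpa [h0] using Nat.find_spec hf)
  have h1 : (f ^ (k + 1)) v = 0 := hk ▸ Nat.find_spec hf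
  have h2 : (f ^ k) v ≠ 0 := Nat.find_min hf (by omega)
  have h3 := t.e_f_pow hv he k
  rw [h1, map_zero, eq_comm, smul_eq_zero, or_iff_left h2, mul_eq_zero,
    or_iff_right (by exact_mod_cast k.succ_ne_zero), sub_eq_zero] at h3
  exact ⟨k, h3, h1⟩

/-- A vector of weight zero killed by `e` is killed by `f`. -/
theorem f_eq_zero_of_e_eq_zero [CharZero K] (t : Sl2Relations e f h) {v : V} (hv : h v = 0)
    (he : e v = 0) (hf : ∃ k, (f ^ k) v = 0) : f v = 0 := by
  by_cases hv0 : v = 0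
  · simp [hv0]
  obtain ⟨k, hk, hk'⟩ := t.exists_natCast_weight (n := 0) (by simpa using hv) he hv0 hf
  obtain rfl : k = 0 := by exact_mod_cast hk.symm
  simpa using hk'

/-- On vectors of weight zero, `f ∘ e` has the same kernel as `e` and does not meet its image. -/
theorem e_eq_zero_of_e_f_e_eq_zero [CharZero K] (t : Sl2Relations e f h) {v : V} (hv : h v = 0)
    (hef : e (f (e v)) = 0) (he : ∃ k, (e ^ k) v = 0) : e v = 0 := by
  obtain ⟨k, hk⟩ := he
  refine t.eq_zero_of_e_f_eq_zero (n := 2) two_ne_zero (by simp [t.h_e, hv]) hef (k := k) ?_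
  rw [← Module.End.mul_apply, ← pow_succ, pow_succ', Module.End.mul_apply, hk, map_zero]

end Sl2Relations

section Derivation

variable {K A : Type*} [CommRing K] [CommRing A] [Algebra K A]

theorem iterate_derivation_mul_eq_zero (D : Derivation K A A) (N : ℕ) :
    ∀ {n m : ℕ} {a b : A}, n + m = N → ((D : Module.End K A) ^ n) a = 0 →
      ((D : Module.End K A) ^ m) b = 0 → ((D : Module.End K A) ^ N) (a * b) = 0 := by
  induction N with
  | zero =>
    intro n m a b h ha hb
    obtain ⟨rfl, rfl⟩ : n = 0 ∧ m = 0 := by omega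
    simp_all
  | succ N ih =>
    intro n m a b h ha hb
    rw [pow_succ, Module.End.mul_apply]
    have : (D : Module.End K A) (a * b) = a * D b + D a * b := by
      simp [mul_comm]
    rw [this, map_add]
    have key1 : ((D : Module.End K A) ^ N) (a * D b) = 0 := by
      cases m with
      | zero => simp at hb; simp [hb]
      | succ m => exact ih (n := n) (m := m) (by omega) ha (by rwa [pow_succ] at hb)
    have key2 : ((D : Module.End K A) ^ N) (D a * b) = 0 := by
      cases n with
      | zero => simp at ha; simp [ha]
      | succ n => exact ih (n := n) (m := m) (by omega) (by rwa [pow_succ] at ha) hb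
    rw [key1, key2, add_zero]

/-- A derivation that is locally nilpotent on the variables is locally nilpotent. -/
theorem exists_pow_derivation_eq_zero {σ : Type*}
    (D : Derivation K (MvPolynomial σ K) (MvPolynomial σ K))
    (hD : ∀ i, ∃ n, ((D : Module.End K (MvPolynomial σ K)) ^ n) (X i) = 0)
    (p : MvPolynomial σ K) : ∃ n, ((D : Module.End K (MvPolynomial σ K)) ^ n) p = 0 := by
  induction p using MvPolynomial.induction_on with
  | C a => exact ⟨1, by simp⟩
  | add p q hp hq =>
    obtain ⟨n, hn⟩ := hp
    obtain ⟨m, hm⟩ := hq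
    refine ⟨n + m, ?_⟩
    rw [map_add, pow_add, Module.End.mul_apply _ _ q, hm, map_zero, add_zero, ← pow_add, add_comm,
      pow_add, Module.End.mul_apply, hn, map_zero]
  | mul_X p i hp =>
    obtain ⟨n, hn⟩ := hp
    obtain ⟨m, hm⟩ := hD i
    exact ⟨n + m, iterate_derivation_mul_eq_zero D _ rfl hn hm⟩

/-- A derivation with linear values on the variables preserves the degree. -/
theorem isHomogeneous_derivation {σ : Type*} [Fintype σ]
    (D : Derivation K (MvPolynomial σ K) (MvPolynomial σ K)) (hD : ∀ i, (D (X i)).IsHomogeneous 1)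
    {p : MvPolynomial σ K} {n : ℕ} (hp : p.IsHomogeneous n) : (D p).IsHomogeneous n := by
  classical
  have hsum : D = ∑ i, D (X i) • pderiv i := by
    refine derivation_ext fun j ↦ ?_
    rw [← Derivation.coeFnAddMonoidHom_apply (∑ i, _), map_sum]
    simp [Finset.sum_apply, pderiv_X, Pi.single_apply]
  cases n with
  | zero =>
    rw [← totalDegree_zero_iff_isHomogeneous, totalDegree_eq_zero_iff_eq_C] at hp
    rw [hp, derivation_C]
    exact isHomogeneous_zero ..
  | succ n =>
    rw [hsum, ← Derivation.coeFnAddMonoidHom_apply, map_sum]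
    simp only [Derivation.coeFnAddMonoidHom_apply, Finset.sum_apply, Derivation.smul_apply, smul_eq_mul]
    refine IsHomogeneous.sum _ _ _ fun i _ ↦ ?_
    rw [add_comm]
    exact (hD i).mul hp.pderiv

theorem coeff_derivation_of_diagonal {σ : Type*} (D : Derivation K (MvPolynomial σ K) (MvPolynomial σ K))
    (w : σ → ℤ) (hD : ∀ i, D (X i) = (w i : K) • X i) (p : MvPolynomial σ K) (s : σ →₀ ℕ) :
    coeff s (D p) = (Finsupp.weight w s : K) * coeff s p := by
  classical
  induction p using MvPolynomial.induction_on generalizing s with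
  | C a =>
    rw [derivation_C, coeff_C]
    split_ifs with h
    · simp [← h]
    · simp
  | add p q hp hq => rw [map_add, coeff_add, hp, hq, coeff_add, mul_add]
  | mul_X p i hp =>
    rw [D.leibniz, hD, smul_eq_mul, smul_eq_mul, mul_smul_comm, mul_comm (X i), coeff_add,
      coeff_smul, coeff_mul_X', coeff_mul_X']
    split_ifs with h
    · rw [hp, ← Finsupp.weight_sub_single_add (w := w) (Finsupp.mem_support_iff.1 h)]
      push_cast
      rw [smul_eq_mul]
      ring
    · simp

end Derivation
theorem homogeneousComponent_mul_of_isHomogeneous {σ R : Type*} [CommRing R]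
    {p q : MvPolynomial σ R} {m : ℕ} (hq : q.IsHomogeneous m) (n : ℕ) :
    homogeneousComponent n (p * q) = if m ≤ n then homogeneousComponent (n - m) p * q else 0 := by
  let : GradedAlgebra (homogeneousSubmodule σ R) := gradedAlgebra
  have hdec (k : ℕ) (φ : MvPolynomial σ R) : homogeneousComponent k φ =
      (DirectSum.decompose (homogeneousSubmodule σ R) φ k : MvPolynomial σ R) :=
    (decomposition.decompose'_apply φ k).symm
  rw [hdec, hdec, DirectSum.coe_decompose_mul_of_right_mem (homogeneousSubmodule σ R) n hq]

/-- **Hilbert's finiteness argument**: a graded subalgebra `A` of a polynomial algebra which has an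
`A`-stable linear complement `N` is finitely generated. -/
theorem fg_of_complement {σ K : Type*} [Finite σ] [Field K]
    (A : Subalgebra K (MvPolynomial σ K)) (N : Submodule K (MvPolynomial σ K))
    (hmul : ∀ a ∈ A, ∀ b ∈ N, a * b ∈ N) (hdisj : ∀ a ∈ A, a ∈ N → a = 0)
    (hspan : ∀ b, ∃ a ∈ A, b - a ∈ N) (hgr : ∀ a ∈ A, ∀ n, homogeneousComponent n a ∈ A) :
    A.FG := by
  classical
  obtain ⟨T, hTS, hT⟩ := (Submodule.fg_span_iff_fg_span_finset_subset
    {t : MvPolynomial σ K | t ∈ A ∧ ∃ m, 0 < m ∧ t.IsHomogeneous m}).1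
      (IsNoetherian.noetherian (R := MvPolynomial σ K) _)
  refine ⟨T, le_antisymm (Algebra.adjoin_le fun t ht ↦ (hTS ht).1) fun a ha ↦ ?_⟩
  have key : ∀ n, ∀ a ∈ A, a.IsHomogeneous n → a ∈ Algebra.adjoin K (T : Set (MvPolynomial σ K)) := by
    intro n
    induction n using Nat.strong_induction_on with
    | _ n ih =>
    intro a ha han
    obtain rfl | hn := n.eq_zero_or_pos
    · rw [← totalDegree_zero_iff_isHomogeneous, totalDegree_eq_zero_iff_eq_C] at han
      rw [han]
      exact Subalgebra.algebraMap_mem _ _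
    have haT : a ∈ Submodule.span (MvPolynomial σ K) (T : Set (MvPolynomial σ K)) :=
      hT ▸ Submodule.subset_span ⟨ha, n, hn, han⟩
    obtain ⟨c, -, hc⟩ := Submodule.mem_span_finset.1 haT
    choose r hrA hrN using fun t ↦ hspan (c t)
    have har : a = ∑ t ∈ T, r t * t := by
      refine sub_eq_zero.1 (hdisj _ (sub_mem ha (sum_mem fun t ht ↦ mul_mem (hrA t) (hTS ht).1)) ?_)
      rw [← hc, ← Finset.sum_sub_distrib]
      refine sum_mem fun t ht ↦ ?_
      rw [smul_eq_mul, ← sub_mul, mul_comm]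
      exact hmul _ (hTS ht).1 _ (hrN t)
    rw [← homogeneousComponent_eq_self han, har, map_sum]
    refine sum_mem fun t ht ↦ ?_
    obtain ⟨-, m, hm, htm⟩ := hTS ht
    rw [homogeneousComponent_mul_of_isHomogeneous htm]
    split_ifs
    · exact mul_mem (ih _ (by omega) _ (hgr _ (hrA t) _) (homogeneousComponent_isHomogeneous ..))
        (Algebra.subset_adjoin ht)
    · exact zero_mem _
  rw [← sum_homogeneousComponent a]
  exact sum_mem fun n _ ↦ key n _ (hgr a ha n) (homogeneousComponent_isHomogeneous ..)

/-- Two derivations `e`, `f` of a polynomial ring which, together with their commutator, form a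
linear `𝔰𝔩₂`-action for which the variable `X i` has weight `w i`. -/
structure IsPolySl2 {σ K : Type*} [Field K] (e f : Derivation K (MvPolynomial σ K) (MvPolynomial σ K))
    (w : σ → ℤ) : Prop where
  h_X : ∀ i, ⁅e, f⁆ (X i) = (w i : K) • X i
  h_e_X : ∀ i, ⁅e, f⁆ (e (X i)) = (w i + 2 : K) • e (X i)
  h_f_X : ∀ i, ⁅e, f⁆ (f (X i)) = (w i - 2 : K) • f (X i)
  isHomogeneous_e : ∀ i, (e (X i)).IsHomogeneous 1
  isHomogeneous_f : ∀ i, (f (X i)).IsHomogeneous 1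
  nilpotent_e : ∀ i, ∃ n, ((e : Module.End K (MvPolynomial σ K)) ^ n) (X i) = 0
  nilpotent_f : ∀ i, ∃ n, ((f : Module.End K (MvPolynomial σ K)) ^ n) (X i) = 0

/-- The common constants of two derivations. -/
def commonConstants {K A : Type*} [CommRing K] [CommRing A] [Algebra K A]
    (e f : Derivation K A A) : Subalgebra K A where
  carrier := {a | e a = 0 ∧ f a = 0}
  mul_mem' := by
    rintro a b ⟨ha, ha'⟩ ⟨hb, hb'⟩
    simp [ha, ha', hb, hb']
  add_mem' := by
    rintro a b ⟨ha, ha'⟩ ⟨hb, hb'⟩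
    simp [ha, ha', hb, hb']
  algebraMap_mem' r := by simp

namespace IsPolySl2

variable {σ K : Type*} [Field K] {e f : Derivation K (MvPolynomial σ K) (MvPolynomial σ K)}
  {w : σ → ℤ}

theorem sl2Relations (t : IsPolySl2 e f w) :
    Sl2Relations (e : Module.End K (MvPolynomial σ K)) f (⁅e, f⁆ : Derivation K _ _) where
  e_f v := (sub_eq_iff_eq_add'.1 (Derivation.commutator_apply (D1 := e) (D2 := f) v).symm)
  h_e v := by
    have : ⁅⁅e, f⁆, e⁆ = (2 : K) • e := derivation_ext fun i ↦ by
      rw [Derivation.commutator_apply, t.h_X, t.h_e_X, Derivation.map_smul, ← sub_smul, add_sub_cancel_left,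
        Derivation.smul_apply]
    have := DFunLike.congr_fun this v
    rwa [Derivation.commutator_apply, Derivation.smul_apply, sub_eq_iff_eq_add'] at this
  h_f v := by
    have : ⁅⁅e, f⁆, f⁆ = (-2 : K) • f := derivation_ext fun i ↦ by
      rw [Derivation.commutator_apply, t.h_X, t.h_f_X, Derivation.map_smul, ← sub_smul, sub_sub_cancel_left,
        Derivation.smul_apply]
    have := DFunLike.congr_fun this v
    rwa [Derivation.commutator_apply, Derivation.smul_apply, sub_eq_iff_eq_add', neg_smul,
      ← sub_eq_add_neg] at this

theorem coeff_h (t : IsPolySl2 e f w) (p : MvPolynomial σ K) (s : σ →₀ ℕ) :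
    coeff s (⁅e, f⁆ p) = (Finsupp.weight w s : K) * coeff s p :=
  coeff_derivation_of_diagonal _ w t.h_X p s

theorem h_monomial (t : IsPolySl2 e f w) (s : σ →₀ ℕ) (a : K) :
    ⁅e, f⁆ (monomial s a) = (Finsupp.weight w s : K) • monomial s a := by
  classical
  ext u
  rw [t.coeff_h, coeff_smul, coeff_monomial]
  split_ifs with h <;> simp [h]

theorem h_eq_zero_of_h_h_eq_zero (t : IsPolySl2 e f w) {p : MvPolynomial σ K}
    (hp : ⁅e, f⁆ (⁅e, f⁆ p) = 0) : ⁅e, f⁆ p = 0 := by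
  ext s
  have := congr_arg (coeff s) hp
  rw [t.coeff_h, t.coeff_h] at this
  rw [t.coeff_h]
  simpa using this

theorem exists_pow_e (t : IsPolySl2 e f w) (p : MvPolynomial σ K) :
    ∃ n, ((e : Module.End K (MvPolynomial σ K)) ^ n) p = 0 :=
  exists_pow_derivation_eq_zero e t.nilpotent_e p

theorem exists_pow_f (t : IsPolySl2 e f w) (p : MvPolynomial σ K) :
    ∃ n, ((f : Module.End K (MvPolynomial σ K)) ^ n) p = 0 :=
  exists_pow_derivation_eq_zero f t.nilpotent_f p

theorem h_f_e (t : IsPolySl2 e f w) {p : MvPolynomial σ K} (hp : ⁅e, f⁆ p = 0) :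
    ⁅e, f⁆ (f (e p)) = 0 := by
  have h1 := t.sl2Relations.h_f (e p)
  have h2 := t.sl2Relations.h_e p
  simp only [Derivation.coeFn_coe] at h1 h2
  rw [h1, h2, hp]
  simp

variable [CharZero K]

theorem e_eq_zero (t : IsPolySl2 e f w) {p : MvPolynomial σ K} (hp : ⁅e, f⁆ p = 0)
    (h : e (f (e p)) = 0) : e p = 0 :=
  t.sl2Relations.e_eq_zero_of_e_f_e_eq_zero hp h (t.exists_pow_e p)

theorem f_eq_zero (t : IsPolySl2 e f w) {p : MvPolynomial σ K} (hp : ⁅e, f⁆ p = 0)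
    (h : e p = 0) : f p = 0 :=
  t.sl2Relations.f_eq_zero_of_e_eq_zero hp h (t.exists_pow_f p)

variable [Fintype σ]

theorem exists_add_of_isHomogeneous (t : IsPolySl2 e f w) {p : MvPolynomial σ K} {n : ℕ}
    (hp : ⁅e, f⁆ p = 0) (hpn : p.IsHomogeneous n) :
    ∃ a ∈ commonConstants e f, ∃ v, ⁅e, f⁆ v = 0 ∧ a + f (e v) = p := by
  let V : Submodule K (MvPolynomial σ K) := homogeneousSubmodule σ K n ⊓
    LinearMap.ker (⁅e, f⁆ : Derivation K (MvPolynomial σ K) (MvPolynomial σ K)).toLinearMap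
  have : FiniteDimensional K (homogeneousSubmodule σ K n) :=
    Module.Finite.iff_fg.2 (homogeneousSubmodule_fg σ K n)
  have : FiniteDimensional K V := Submodule.finiteDimensional_inf_left _ _
  let T : V →ₗ[K] V := ((f : Module.End K (MvPolynomial σ K)) * e).restrict fun v hv ↦
    ⟨isHomogeneous_derivation f t.isHomogeneous_f
      (isHomogeneous_derivation e t.isHomogeneous_e hv.1), t.h_f_e hv.2⟩
  have hT (v : V) : (T v : MvPolynomial σ K) = f (e v) := rfl
  have hker {v : V} (hv : T v = 0) : e (v : MvPolynomial σ K) = 0 :=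
    t.e_eq_zero v.2.2 (by rw [← hT, hv]; simp)
  have htop : LinearMap.range T ⊔ LinearMap.ker T = ⊤ := by
    refine Submodule.eq_top_of_disjoint _ _ (LinearMap.finrank_range_add_finrank_ker T).ge ?_
    rw [Submodule.disjoint_def]
    rintro _ ⟨v, rfl⟩ hv
    ext1
    rw [hT, t.e_eq_zero v.2.2 (hker hv)]
    simp
  obtain ⟨_, ⟨v, rfl⟩, a, ha, hav⟩ := Submodule.mem_sup.1
    (htop ▸ Submodule.mem_top : (⟨p, hpn, hp⟩ : V) ∈ LinearMap.range T ⊔ LinearMap.ker T)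
  have hea := hker (LinearMap.mem_ker.1 ha)
  refine ⟨a, ⟨hea, t.f_eq_zero a.2.2 hea⟩, v, v.2.2, ?_⟩
  rw [add_comm]
  exact congr_arg Subtype.val hav

/-- The invariants of a linear `𝔰𝔩₂`-action on a polynomial algebra are finitely generated. -/
theorem fg_commonConstants (t : IsPolySl2 e f w) : (commonConstants e f).FG := by
  let h : Derivation K (MvPolynomial σ K) (MvPolynomial σ K) := ⁅e, f⁆
  let N : Submodule K (MvPolynomial σ K) := LinearMap.range (h : Module.End K (MvPolynomial σ K)) ⊔
    (LinearMap.ker (h : Module.End K (MvPolynomial σ K))).map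
      ((f : Module.End K (MvPolynomial σ K)) * (e : Module.End K (MvPolynomial σ K)))
  have hN {p} : p ∈ N ↔ ∃ u v, h v = 0 ∧ h u + f (e v) = p := by
    simp [N, Submodule.mem_sup]
  have hA {a} (ha : a ∈ commonConstants e f) : h a = 0 := by
    simp [h, Derivation.commutator_apply, ha.1, ha.2]
  refine fg_of_complement _ N ?_ ?_ ?_ ?_
  · intro a ha b hb
    obtain ⟨u, v, hv, rfl⟩ := hN.1 hb
    refine hN.2 ⟨a * u, a * v, by simp [hA ha, hv], ?_⟩
    simp [hA ha, ha.1, ha.2, mul_add]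
  · intro a ha haN
    obtain ⟨u, v, hv, rfl⟩ := hN.1 haN
    have hu : h u = 0 := by
      refine t.h_eq_zero_of_h_h_eq_zero ?_
      have := hA ha
      rwa [map_add, t.h_f_e hv, add_zero] at this
    rw [hu, zero_add] at ha ⊢
    rw [t.e_eq_zero hv ha.1, map_zero]
  · intro b
    induction b using MvPolynomial.induction_on' with
    | add p q hp hq =>
      obtain ⟨a, ha, ha'⟩ := hp
      obtain ⟨b, hb, hb'⟩ := hq
      exact ⟨a + b, add_mem ha hb, by simpa [add_sub_add_comm] using add_mem ha' hb'⟩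
    | monomial s c =>
      by_cases hs : Finsupp.weight w s = 0
      · obtain ⟨a, ha, v, hv, hav⟩ := t.exists_add_of_isHomogeneous (p := monomial s c)
          (by simp [t.h_monomial, hs]) (isHomogeneous_monomial c rfl)
        exact ⟨a, ha, hN.2 ⟨0, v, hv, by simp [← hav]⟩⟩
      · refine ⟨0, zero_mem _, hN.2 ⟨(Finsupp.weight w s : K)⁻¹ • monomial s c, 0, map_zero _, ?_⟩⟩
        rw [Derivation.map_smul, t.h_monomial, smul_smul, inv_mul_cancel₀ (by exact_mod_cast hs)]
        simp
  · have hcomm (D : Derivation K (MvPolynomial σ K) (MvPolynomial σ K))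
        (hD : ∀ i, (D (X i)).IsHomogeneous 1) (a : MvPolynomial σ K) (n : ℕ) :
        D (homogeneousComponent n a) = homogeneousComponent n (D a) := by
      induction a using MvPolynomial.induction_on' with
      | add p q hp hq => simp [hp, hq]
      | monomial s c =>
        have hs := isHomogeneous_monomial (d := s) c rfl
        rw [homogeneousComponent_of_mem hs,
          homogeneousComponent_of_mem (isHomogeneous_derivation D hD hs)]
        split_ifs <;> simp
    intro a ha n
    exact ⟨by rw [hcomm e t.isHomogeneous_e, ha.1, map_zero],
      by rw [hcomm f t.isHomogeneous_f, ha.2, map_zero]⟩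

end IsPolySl2

section Extension

variable {σ K : Type*} [Field K]

/-- Extend a derivation of `K[σ]` to two more variables, on which it takes the values `u`. -/
noncomputable def extendDerivation (D : Derivation K (MvPolynomial σ K) (MvPolynomial σ K))
    (u : Fin 2 → MvPolynomial (σ ⊕ Fin 2) K) :
    Derivation K (MvPolynomial (σ ⊕ Fin 2) K) (MvPolynomial (σ ⊕ Fin 2) K) :=
  mkDerivation K (Sum.elim (fun i ↦ rename Sum.inl (D (X i))) u)

variable (D : Derivation K (MvPolynomial σ K) (MvPolynomial σ K))
  (u : Fin 2 → MvPolynomial (σ ⊕ Fin 2) K)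

@[simp]
theorem extendDerivation_X_inr (j : Fin 2) : extendDerivation D u (X (Sum.inr j)) = u j := by
  simp [extendDerivation]

theorem extendDerivation_X_inl (i : σ) :
    extendDerivation D u (X (Sum.inl i)) = rename Sum.inl (D (X i)) := by
  simp [extendDerivation]

@[simp]
theorem extendDerivation_rename (p : MvPolynomial σ K) :
    extendDerivation D u (rename Sum.inl p) = rename Sum.inl (D p) := by
  induction p using MvPolynomial.induction_on with
  | C a => simp
  | add p q hp hq => simp [hp, hq]
  | mul_X p i hp =>
    rw [map_mul, rename_X, Derivation.leibniz, hp, extendDerivation_X_inl, Derivation.leibniz]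
    simp

theorem extendDerivation_pow_rename (n : ℕ) (p : MvPolynomial σ K) :
    ((extendDerivation D u : Module.End K (MvPolynomial (σ ⊕ Fin 2) K)) ^ n) (rename Sum.inl p) =
      rename Sum.inl (((D : Module.End K (MvPolynomial σ K)) ^ n) p) := by
  induction n with
  | zero => simp
  | succ n ih => simp [pow_succ', ih]

end Extension

namespace IsPolySl2

variable {σ K : Type*} [Field K] {e f : Derivation K (MvPolynomial σ K) (MvPolynomial σ K)}
  {w : σ → ℤ}

theorem extend (t : IsPolySl2 e f w) :
    IsPolySl2 (extendDerivation e ![0, X (Sum.inr 0)]) (extendDerivation f ![X (Sum.inr 1), 0])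
      (Sum.elim w ![1, -1]) where
  h_X := by
    rintro (i | j)
    · have := congr_arg (rename (Sum.inl : σ → σ ⊕ Fin 2)) (t.h_X i)
      simpa [Derivation.commutator_apply, extendDerivation_X_inl] using this
    · fin_cases j <;> simp [Derivation.commutator_apply]
  h_e_X := by
    rintro (i | j)
    · have := congr_arg (rename (Sum.inl : σ → σ ⊕ Fin 2)) (t.h_e_X i)
      simpa [Derivation.commutator_apply, extendDerivation_X_inl] using this
    · fin_cases j
      · simp
      · simp [Derivation.commutator_apply]
        norm_num
  h_f_X := by
    rintro (i | j)
    · have := congr_arg (rename (Sum.inl : σ → σ ⊕ Fin 2)) (t.h_f_X i)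
      simpa [Derivation.commutator_apply, extendDerivation_X_inl] using this
    · fin_cases j
      · simp [Derivation.commutator_apply]
        norm_num
      · simp
  isHomogeneous_e := by
    rintro (i | j)
    · rw [extendDerivation_X_inl]
      exact (t.isHomogeneous_e i).rename_isHomogeneous
    · fin_cases j
      · simpa using isHomogeneous_zero ..
      · simpa using isHomogeneous_X ..
  isHomogeneous_f := by
    rintro (i | j)
    · rw [extendDerivation_X_inl]
      exact (t.isHomogeneous_f i).rename_isHomogeneous
    · fin_cases j
      · simpa using isHomogeneous_X ..
      · simpa using isHomogeneous_zero ..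
  nilpotent_e := by
    rintro (i | j)
    · obtain ⟨n, hn⟩ := t.nilpotent_e i
      exact ⟨n, by rw [← rename_X Sum.inl i, extendDerivation_pow_rename, hn, map_zero]⟩
    · exact ⟨2, by fin_cases j <;> simp [pow_two]⟩
  nilpotent_f := by
    rintro (i | j)
    · obtain ⟨n, hn⟩ := t.nilpotent_f i
      exact ⟨n, by rw [← rename_X Sum.inl i, extendDerivation_pow_rename, hn, map_zero]⟩
    · exact ⟨2, by fin_cases j <;> simp [pow_two]⟩

end IsPolySl2

section Constants

variable {σ K : Type*} [Field K]

/-- The algebra of constants of a derivation. -/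
def constants {K A : Type*} [CommRing K] [CommRing A] [Algebra K A] (e : Derivation K A A) :
    Subalgebra K A := commonConstants e e

theorem mem_constants {K A : Type*} [CommRing K] [CommRing A] [Algebra K A]
    {e : Derivation K A A} {a : A} : a ∈ constants e ↔ e a = 0 := and_self_iff

/-- The specialization of the two additional variables to `0` and `1`. -/
noncomputable def specialize : MvPolynomial (σ ⊕ Fin 2) K →ₐ[K] MvPolynomial σ K :=
  aeval (Sum.elim X ![0, 1])

@[simp]
theorem specialize_rename (p : MvPolynomial σ K) : specialize (rename Sum.inl p) = p := by
  rw [specialize, aeval_rename]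
  exact aeval_X_left_apply p

theorem specialize_extendDerivation (e : Derivation K (MvPolynomial σ K) (MvPolynomial σ K))
    (p : MvPolynomial (σ ⊕ Fin 2) K) :
    specialize (extendDerivation e ![0, X (Sum.inr 0)] p) = e (specialize p) := by
  induction p using MvPolynomial.induction_on with
  | C a => simp [specialize]
  | add p q hp hq => simp [hp, hq]
  | mul_X p i hp =>
    obtain i | j := i
    · rw [Derivation.leibniz, map_add, smul_eq_mul, smul_eq_mul, map_mul, map_mul, hp,
        extendDerivation_X_inl, specialize_rename, map_mul, Derivation.leibniz]
      simp [specialize]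
    · fin_cases j <;> simp [specialize] at hp ⊢
      all_goals simp [hp]

end Constants

namespace IsPolySl2

variable {σ K : Type*} [Field K]
  {e f : Derivation K (MvPolynomial σ K) (MvPolynomial σ K)} {w : σ → ℤ}

theorem h_of_isWeightedHomogeneous (t : IsPolySl2 e f w) {a : MvPolynomial σ K} {n : ℤ}
    (ha : a.IsWeightedHomogeneous w n) : ⁅e, f⁆ a = (n : K) • a := by
  ext s
  rw [t.coeff_h, coeff_smul, smul_eq_mul]
  by_cases hs : coeff s a = 0
  · simp [hs]
  · rw [ha hs]

variable [CharZero K]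

theorem exists_specialize_eq_of_weight (t : IsPolySl2 e f w) {a : MvPolynomial σ K} {n : K}
    (hn : ⁅e, f⁆ a = n • a) (ha : e a = 0) :
    ∃ b ∈ commonConstants (extendDerivation e ![0, X (Sum.inr 0)])
      (extendDerivation f ![X (Sum.inr 1), 0]), specialize b = a := by
  by_cases ha0 : a = 0
  · exact ⟨0, zero_mem _, by simp [ha0]⟩
  obtain ⟨k, rfl, hk⟩ := t.sl2Relations.exists_natCast_weight hn ha ha0 (t.exists_pow_f a)
  have hefa := t.sl2Relations.e_f_pow hn ha
  have hhfa := t.sl2Relations.symm.h_e_pow (v := a) (n := -k) (by rw [neg_smul, ← hn]; rfl)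
  set E := extendDerivation e ![0, X (Sum.inr 0)] with hE
  set F := extendDerivation f ![X (Sum.inr 1), 0] with hF
  set g : ℕ → MvPolynomial (σ ⊕ Fin 2) K := fun i ↦
    rename Sum.inl (((f : Module.End K (MvPolynomial σ K)) ^ i) a) with hg
  set x : MvPolynomial (σ ⊕ Fin 2) K := X (Sum.inr 0) with hx
  set y : MvPolynomial (σ ⊕ Fin 2) K := X (Sum.inr 1) with hy
  have hEg0 : E (g 0) = 0 := by simp [hE, hg, ha]
  have hEg (i : ℕ) : E (g (i + 1)) = ((i + 1) * (k - i) : K) • g i := by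
    have := hefa i
    simp only [Derivation.coeFn_coe] at this
    simp only [hE, hg, extendDerivation_rename, this, map_smul]
  have hHg (i : ℕ) : ⁅E, F⁆ (g i) = (k - 2 * i : K) • g i := by
    have := hhfa i
    simp only [LinearMap.neg_apply, Derivation.coeFn_coe, neg_eq_iff_eq_neg] at this
    rw [Derivation.commutator_apply] at this ⊢
    simp only [hE, hF, hg, extendDerivation_rename]
    rw [← map_sub, this, ← neg_smul, map_smul]
    congr 2; ring
  have hEx : E x = 0 := by simp [hE, hx]
  have hEy : E y = x := by simp [hE, hy, hx]
  have hHx : ⁅E, F⁆ x = x := by simp [hE, hF, hy, hx, Derivation.commutator_apply]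
  have hHy : ⁅E, F⁆ y = -y := by simp [hE, hF, hy, hx, Derivation.commutator_apply]
  let c : ℕ → K := fun i ↦ (-1) ^ i / i.factorial
  have hc (i : ℕ) : c (i + 1) * (i + 1) = - c i := by
    have : (i.factorial : K) ≠ 0 := by exact_mod_cast i.factorial_ne_zero
    have : (i + 1 : K) ≠ 0 := by exact_mod_cast i.succ_ne_zero
    simp only [c, Nat.factorial_succ]
    push_cast
    field_simp
    ring
  let b := ∑ i ∈ Finset.range (k + 1), c i • (g i * x ^ i * y ^ (k - i))
  have hEb : E b = 0 := by
    have hsum (m : ℕ) (hm : m ≤ k) :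
        E (∑ i ∈ Finset.range (m + 1), c i • (g i * x ^ i * y ^ (k - i))) =
          (c m * (k - m)) • (g m * x ^ (m + 1) * y ^ (k - m - 1)) := by
      induction m with
      | zero =>
        simp [Derivation.leibniz, Derivation.leibniz_pow, hEg0, hEy, Algebra.smul_def]
        ring
      | succ m ih =>
        rw [Finset.sum_range_succ, map_add, ih (by omega), Derivation.map_smul, Derivation.leibniz,
          Derivation.leibniz, Derivation.leibniz_pow, Derivation.leibniz_pow, hEx, hEy, hEg,
          Nat.cast_succ, ← Nat.sub_sub, ← sub_sub]
        have := congr_arg (algebraMap K (MvPolynomial (σ ⊕ Fin 2) K)) (hc m)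
        have hkm : ((k - m - 1 : ℕ) : K) = k - m - 1 := by
          rw [Nat.sub_sub, Nat.cast_sub hm]; push_cast; ring
        have hkm' := congr_arg (algebraMap K (MvPolynomial (σ ⊕ Fin 2) K)) hkm
        simp only [nsmul_eq_mul, smul_eq_mul]
        simp only [Algebra.smul_def, map_mul, map_sub, map_neg, map_add,
          map_one, map_natCast] at this hkm' ⊢
        rw [hkm']
        linear_combination ((k : MvPolynomial (σ ⊕ Fin 2) K) - m) * g m * x ^ (m + 1) *
          y ^ (k - m - 1) * this
    rw [hsum k le_rfl, sub_self, mul_zero, zero_smul]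
  have hHb : ⁅E, F⁆ b = 0 := by
    have hHx' (i : ℕ) : ⁅E, F⁆ (x ^ i) = (i : K) • x ^ i := by
      induction i with
      | zero => simp
      | succ i ih =>
        rw [pow_succ, Derivation.leibniz, ih, hHx]
        simp [Algebra.smul_def]
        ring
    have hHy' (i : ℕ) : ⁅E, F⁆ (y ^ i) = (-i : K) • y ^ i := by
      induction i with
      | zero => simp
      | succ i ih =>
        rw [pow_succ, Derivation.leibniz, ih, hHy]
        simp [Algebra.smul_def]
        ring
    rw [map_sum]
    refine Finset.sum_eq_zero fun i hi ↦ ?_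
    rw [Derivation.map_smul, Derivation.leibniz, Derivation.leibniz, hHg, hHx', hHy',
      Nat.cast_sub (Finset.mem_range_succ_iff.1 hi)]
    simp only [smul_eq_mul, Algebra.smul_def, map_mul, map_sub, map_neg, map_natCast, map_ofNat]
    ring
  refine ⟨b, ⟨hEb, t.extend.f_eq_zero hHb hEb⟩, ?_⟩
  have hsx : specialize x = (0 : MvPolynomial σ K) := by simp [specialize, hx]
  have hsy : specialize y = (1 : MvPolynomial σ K) := by simp [specialize, hy]
  simp [b, Finset.sum_range_succ', hsx, hsy, c, hg]

theorem e_weightedHomogeneousComponent (t : IsPolySl2 e f w) (a : MvPolynomial σ K) (n : ℤ) :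
    e (weightedHomogeneousComponent w n a) = weightedHomogeneousComponent w (n + 2) (e a) := by
  have hw {p : MvPolynomial σ K} {m : ℤ} (hp : ⁅e, f⁆ p = (m : K) • p) :
      p.IsWeightedHomogeneous w m := by
    intro s hs
    have := congr_arg (coeff s) hp
    rw [t.coeff_h, coeff_smul, smul_eq_mul, mul_left_inj' hs] at this
    exact_mod_cast this
  induction a using MvPolynomial.induction_on' with
  | add p q hp hq => simp [hp, hq]
  | monomial s c =>
    have hs := t.h_monomial s c
    have hes : ⁅e, f⁆ (e (monomial s c)) = ((Finsupp.weight w s + 2 : ℤ) : K) • e (monomial s c) := by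
      have := t.sl2Relations.h_e (monomial s c)
      simp only [Derivation.coeFn_coe] at this
      rw [this, hs, Derivation.map_smul, ← add_smul]
      push_cast
      rfl
    rw [weightedHomogeneousComponent_of_mem (hw hs),
      weightedHomogeneousComponent_of_mem (hw hes)]
    simp only [add_left_inj]
    split_ifs <;> simp

/-- The kernel of the raising operator of a linear `𝔰𝔩₂`-action is finitely generated. -/
theorem fg_constants [Fintype σ] (t : IsPolySl2 e f w) : (constants e).FG := by
  have : constants e = (commonConstants (extendDerivation e ![0, X (Sum.inr 0)])
      (extendDerivation f ![X (Sum.inr 1), 0])).map specialize := by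
    refine le_antisymm (fun a ha ↦ ?_) ?_
    · rw [← finsum_weightedHomogeneousComponent w a]
      refine finsum_induction (· ∈ Subalgebra.map _ _) (zero_mem _) (fun _ _ ↦ add_mem) fun n ↦ ?_
      refine t.exists_specialize_eq_of_weight (n := n) (t.h_of_isWeightedHomogeneous
        (weightedHomogeneousComponent_isWeightedHomogeneous ..)) ?_
      rw [t.e_weightedHomogeneousComponent, mem_constants.1 ha, map_zero]
    · rintro _ ⟨b, hb, rfl⟩
      refine mem_constants.2 ?_
      exact (specialize_extendDerivation e b).symm.trans (by rw [hb.1, map_zero])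
  rw [this]
  exact t.extend.fg_commonConstants.map _

end IsPolySl2

section JordanBasis
open scoped DirectSum

variable {K : Type*} [Field K]

/-- The residue classes of the powers of `X` form a basis of `K[X] ⧸ (X ^ n)`. -/
theorem exists_basis_quotient_X_pow (n : ℕ) :
    ∃ b : Module.Basis (Fin n) K
      (Polynomial K ⧸ Submodule.span (Polynomial K) {(Polynomial.X : Polynomial K) ^ n}),
      ∀ j, b j = Submodule.Quotient.mk (Polynomial.X ^ (j : ℕ)) := by
  let pb := AdjoinRoot.powerBasis' (Polynomial.monic_X_pow (R := K) n)
  have hdim : pb.dim = n := Polynomial.natDegree_X_pow n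
  refine ⟨pb.basis.reindex (finCongr hdim), fun j ↦ ?_⟩
  have : (pb.basis.reindex (finCongr hdim)) j = pb.gen ^ (j : ℕ) := by
    rw [Module.Basis.reindex_apply, pb.basis_eq_pow]
    rfl
  exact this

/-- A nilpotent endomorphism admits a Jordan basis. -/
theorem exists_jordan_basis {V : Type*} [AddCommGroup V] [Module K V] [FiniteDimensional K V]
    {φ : Module.End K V} (hφ : IsNilpotent φ) :
    ∃ (r : ℕ) (k : Fin r → ℕ) (b : Module.Basis (Σ i, Fin (k i)) K V), ∀ i (j : Fin (k i)),
      φ (b ⟨i, j⟩) = if h : (j : ℕ) + 1 < k i then b ⟨i, j + 1, h⟩ else 0 := by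
  classical
  obtain ⟨N, hN⟩ := hφ
  have htors : Module.IsTorsion' (Module.AEval' φ)
      (Submonoid.powers (Polynomial.X : Polynomial K)) := by
    intro v
    obtain ⟨v, rfl⟩ := (Module.AEval'.of φ).surjective v
    exact ⟨⟨_, N, rfl⟩, by
      rw [Submonoid.smul_def, Module.AEval'.X_pow_smul_of, hN, zero_smul, map_zero]⟩
  have : Module.Finite (Polynomial K) (Module.AEval' φ) :=
    Module.Finite.of_restrictScalars_finite K _ _
  obtain ⟨r, k, ⟨L⟩⟩ := Module.torsion_by_prime_power_decomposition
    Polynomial.irreducible_X htors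
  choose q hq using fun i ↦ exists_basis_quotient_X_pow (K := K) (k i)
  let b : Module.Basis (Σ i, Fin (k i)) K V :=
    (DFinsupp.basis q).map ((L.restrictScalars K).symm.trans (Module.AEval'.of φ).symm)
  have hb (i) (j : Fin (k i)) : L (Module.AEval'.of φ (b ⟨i, j⟩)) = DirectSum.lof (Polynomial K) _
      (fun i ↦ Polynomial K ⧸ Submodule.span (Polynomial K) {(Polynomial.X : Polynomial K) ^ k i}) i
        (Submodule.Quotient.mk (Polynomial.X ^ (j : ℕ))) := by
    have h : DFinsupp.basis q ⟨i, j⟩ = DFinsupp.single i (q i j) := by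
      apply (DFinsupp.basis q).repr.injective
      rw [Module.Basis.repr_self]
      ext ⟨i', j'⟩
      by_cases hi : i = i'
      · subst hi
        simp [DFinsupp.basis, Finsupp.single_apply, Sigma.mk.injEq]
      · simp [DFinsupp.basis, hi, DFinsupp.single_eq_of_ne (Ne.symm hi)]
    rw [← hq]
    have h' : L (Module.AEval'.of φ (b ⟨i, j⟩)) = DFinsupp.basis q ⟨i, j⟩ := by simp [b]
    rw [h', h]
    rfl
  refine ⟨r, k, b, fun i j ↦ ?_⟩
  apply (Module.AEval'.of φ).injective
  apply L.injective
  rw [← Module.AEval'.X_smul_of, map_smul, hb, ← map_smul, ← Submodule.Quotient.mk_smul, smul_eq_mul,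
    ← pow_succ']
  split_ifs with h
  · rw [hb]
  · have : (j : ℕ) + 1 = k i := by omega
    rw [this, (Submodule.Quotient.mk_eq_zero _).2 (Submodule.mem_span_singleton_self _)]
    simp

end JordanBasis

section JordanBlocks

variable {K : Type*} [Field K] {r : ℕ} (k : Fin r → ℕ)

/-- The `n`-th variable of the `i`-th block, or zero beyond the end of the block. -/
noncomputable def blockVar (i : Fin r) (n : ℕ) : MvPolynomial (Σ i, Fin (k i)) K :=
  if h : n < k i then X ⟨i, n, h⟩ else 0

theorem blockVar_of_lt {i : Fin r} {n : ℕ} (h : n < k i) :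
    blockVar (K := K) k i n = X ⟨i, n, h⟩ := dif_pos h

theorem blockVar_of_le {i : Fin r} {n : ℕ} (h : k i ≤ n) :
    blockVar (K := K) k i n = 0 := dif_neg h.not_gt

theorem blockVar_mk (s : Σ i, Fin (k i)) : blockVar (K := K) k s.1 s.2 = X s :=
  blockVar_of_lt k s.2.2

theorem isHomogeneous_blockVar (i : Fin r) (n : ℕ) :
    (blockVar (K := K) k i n).IsHomogeneous 1 := by
  unfold blockVar
  split_ifs
  · exact isHomogeneous_X K _
  · exact isHomogeneous_zero _ _ _

variable (K) in
/-- The derivation shifting the variables of each block up. -/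
noncomputable def raising :
    Derivation K (MvPolynomial (Σ i, Fin (k i)) K) (MvPolynomial (Σ i, Fin (k i)) K) :=
  mkDerivation K fun s ↦ blockVar k s.1 (s.2 + 1)

variable (K) in
/-- The derivation shifting the variables of each block down, scaled to complete `raising` to an
`sl₂`-triple. -/
noncomputable def lowering :
    Derivation K (MvPolynomial (Σ i, Fin (k i)) K) (MvPolynomial (Σ i, Fin (k i)) K) :=
  mkDerivation K fun s ↦ ((s.2 : ℕ) * (k s.1 - (s.2 : ℕ)) : K) • blockVar k s.1 (s.2 - 1)

theorem raising_blockVar (i : Fin r) (n : ℕ) :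
    raising K k (blockVar k i n) = blockVar k i (n + 1) := by
  rcases lt_or_ge n (k i) with h | h
  · rw [blockVar_of_lt k h, raising, mkDerivation_X]
  · rw [blockVar_of_le k h, blockVar_of_le k (h.trans n.le_succ), map_zero]

theorem lowering_blockVar_succ (i : Fin r) (n : ℕ) :
    lowering K k (blockVar k i (n + 1)) =
      (((n : K) + 1) * (k i - (n + 1))) • blockVar k i n := by
  rcases lt_or_ge (n + 1) (k i) with h | h
  · rw [blockVar_of_lt k h, lowering, mkDerivation_X]
    simp
  · rw [blockVar_of_le k h, map_zero]
    rcases h.eq_or_lt with h | h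
    · simp [h]
    · rw [blockVar_of_le k (Nat.le_of_lt_succ h), smul_zero]

theorem lowering_blockVar_zero (i : Fin r) : lowering K k (blockVar k i 0) = 0 := by
  rcases lt_or_ge 0 (k i) with h | h
  · rw [blockVar_of_lt k h, lowering, mkDerivation_X]
    simp
  · rw [blockVar_of_le k h, map_zero]

theorem commutator_blockVar (i : Fin r) (n : ℕ) :
    ⁅raising K k, lowering K k⁆ (blockVar k i n) =
      (2 * (n : K) - k i + 1) • blockVar k i n := by
  rw [Derivation.commutator_apply, raising_blockVar, lowering_blockVar_succ]
  cases n with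
  | zero =>
    rw [lowering_blockVar_zero, map_zero, zero_sub, ← neg_smul]
    congr 1
    push_cast
    ring
  | succ n =>
    rw [lowering_blockVar_succ, Derivation.map_smul, raising_blockVar, ← sub_smul]
    congr 1
    push_cast
    ring

theorem raising_pow_blockVar (i : Fin r) (m n : ℕ) :
    ((raising K k : Module.End K (MvPolynomial (Σ i, Fin (k i)) K)) ^ m) (blockVar k i n) =
      blockVar k i (n + m) := by
  induction m with
  | zero => simp
  | succ m ih =>
    rw [pow_succ', Module.End.mul_apply, ih]
    exact raising_blockVar k i (n + m)

theorem lowering_pow_blockVar (i : Fin r) (n : ℕ) :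
    ((lowering K k : Module.End K (MvPolynomial (Σ i, Fin (k i)) K)) ^ (n + 1))
      (blockVar k i n) = 0 := by
  induction n with
  | zero => simpa using lowering_blockVar_zero k i
  | succ n ih =>
    rw [pow_succ, Module.End.mul_apply, Derivation.coeFn_coe, lowering_blockVar_succ, map_smul, ih,
      smul_zero]

theorem isPolySl2_raising_lowering :
    IsPolySl2 (raising K k) (lowering K k) fun s ↦ 2 * (s.2 : ℕ) - k s.1 + 1 where
  h_X s := by
    rw [← blockVar_mk, commutator_blockVar]
    push_cast
    rfl
  h_e_X s := by
    rw [← blockVar_mk, raising_blockVar, commutator_blockVar]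
    congr 1
    push_cast
    ring
  h_f_X s := by
    rw [← blockVar_mk]
    rcases hs : (s.2 : ℕ) with _ | n
    · simp [lowering_blockVar_zero]
    · rw [lowering_blockVar_succ, Derivation.map_smul, commutator_blockVar, smul_comm]
      congr 1
      push_cast
      ring
  isHomogeneous_e s := by
    rw [← blockVar_mk, raising_blockVar]
    exact isHomogeneous_blockVar k _ _
  isHomogeneous_f s := by
    rw [lowering, mkDerivation_X, smul_eq_C_mul]
    exact (isHomogeneous_blockVar k _ _).C_mul _
  nilpotent_e s := ⟨k s.1, by
    rw [← blockVar_mk, raising_pow_blockVar, blockVar_of_le k (Nat.le_add_left _ _)]⟩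
  nilpotent_f s := ⟨s.2 + 1, by rw [← blockVar_mk, lowering_pow_blockVar]⟩

end JordanBlocks

section Transfer

variable {K : Type*} [Field K]

theorem vecMulLinear_pow_apply {d : ℕ} (c : Matrix (Fin d) (Fin d) K) (n : ℕ) (v : Fin d → K) :
    (Matrix.vecMulLinear c ^ n) v = Matrix.vecMul v (c ^ n) := by
  induction n with
  | zero => simp
  | succ n ih => rw [pow_succ', Module.End.mul_apply, ih, pow_succ, ← Matrix.vecMul_vecMul]; rfl

theorem isNilpotent_vecMulLinear {d : ℕ} {c : Matrix (Fin d) (Fin d) K} (hc : IsNilpotent c) :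
    IsNilpotent (Matrix.vecMulLinear c : Module.End K (Fin d → K)) := by
  obtain ⟨n, hn⟩ := hc
  exact ⟨n, LinearMap.ext fun v ↦ by simp [vecMulLinear_pow_apply, hn]⟩

/-- A basis of the space of linear forms is a system of polynomial generators. -/
theorem exists_algEquiv_of_basis {σ ι : Type*} [Fintype ι] (b : Module.Basis σ K (ι → K)) :
    ∃ Φ : MvPolynomial σ K ≃ₐ[K] MvPolynomial ι K,
      ∀ s, Φ (X s) = Fintype.linearCombination K X (b s) := by
  classical
  let lin : (ι → K) →ₗ[K] MvPolynomial ι K := Fintype.linearCombination K X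
  let lin' : (ι → K) →ₗ[K] MvPolynomial σ K := b.constr K X
  let Φ : MvPolynomial σ K →ₐ[K] MvPolynomial ι K := aeval fun s ↦ lin (b s)
  let Ψ : MvPolynomial ι K →ₐ[K] MvPolynomial σ K := aeval fun i ↦ lin' (Pi.single i 1)
  have hlin (i : ι) : lin (Pi.single i 1) = X i := by
    simp [lin, Fintype.linearCombination_apply_single]
  have hlin' (s : σ) : lin' (b s) = X s := b.constr_basis K X s
  have hΦ : Φ.toLinearMap ∘ₗ lin' = lin := b.ext fun s ↦ by simp [Φ, hlin']
  have hΨ : Ψ.toLinearMap ∘ₗ lin = lin' := (Pi.basisFun K ι).ext fun i ↦ by simp [Ψ, hlin]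
  refine ⟨AlgEquiv.ofAlgHom Φ Ψ ?_ ?_, fun s ↦ aeval_X _ s⟩
  · refine algHom_ext fun i ↦ ?_
    simpa [Ψ, hlin] using LinearMap.congr_fun hΦ (Pi.single i 1)
  · refine algHom_ext fun s ↦ ?_
    simpa [Φ, hlin'] using LinearMap.congr_fun hΨ (b s)

theorem fg_constants_of_algEquiv {A B : Type*} [CommRing A] [Algebra K A] [CommRing B] [Algebra K B]
    {D : Derivation K A A} {E : Derivation K B B} (Φ : A ≃ₐ[K] B) (h : ∀ a, E (Φ a) = Φ (D a))
    (hD : (constants D).FG) : (constants E).FG := by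
  have : constants E = (constants D).map Φ.toAlgHom := by
    ext x
    obtain ⟨a, rfl⟩ := Φ.surjective x
    simp [mem_constants, h]
  rw [this]
  exact hD.map _

theorem derivation_algEquiv_comm {σ B : Type*} [CommRing B] [Algebra K B]
    {D : Derivation K (MvPolynomial σ K) (MvPolynomial σ K)} {E : Derivation K B B}
    (Φ : MvPolynomial σ K ≃ₐ[K] B) (h : ∀ s, E (Φ (X s)) = Φ (D (X s))) (p : MvPolynomial σ K) :
    E (Φ p) = Φ (D p) := by
  induction p using MvPolynomial.induction_on with
  | C a =>
    rw [← algebraMap_eq, AlgEquiv.commutes, Derivation.map_algebraMap, Derivation.map_algebraMap,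
      map_zero]
  | add p q hp hq => simp [hp, hq]
  | mul_X p s hp => simp [hp, h]

theorem fg_constants_of_isNilpotent [CharZero K] {d : ℕ}
    {δ : Derivation K (MvPolynomial (Fin d) K) (MvPolynomial (Fin d) K)}
    {c : Matrix (Fin d) (Fin d) K} (hδ : ∀ i, δ (X i) = ∑ j, c i j • X j) (hc : IsNilpotent c) :
    (constants δ).FG := by
  obtain ⟨r, k, b, hb⟩ := exists_jordan_basis (isNilpotent_vecMulLinear hc)
  obtain ⟨Φ, hΦ⟩ := exists_algEquiv_of_basis b
  have hlin : (δ : MvPolynomial (Fin d) K →ₗ[K] MvPolynomial (Fin d) K) ∘ₗ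
      Fintype.linearCombination K X = Fintype.linearCombination K X ∘ₗ Matrix.vecMulLinear c :=
    (Pi.basisFun K (Fin d)).ext fun i ↦ by
      simp [Fintype.linearCombination_apply, Pi.single_apply, hδ, Matrix.row]
  refine fg_constants_of_algEquiv Φ (derivation_algEquiv_comm Φ fun s ↦ ?_)
    (isPolySl2_raising_lowering k).fg_constants
  have hs : δ (Φ (X s)) = Fintype.linearCombination K X (Matrix.vecMulLinear c (b s)) := by
    rw [hΦ]
    exact LinearMap.congr_fun hlin (b s)
  rw [hs, hb s.1 s.2, ← blockVar_mk, raising_blockVar, blockVar]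
  split_ifs
  · rw [hΦ]
  · simp

end Transfer

end Weitzenboeck

/-- **Weitzenböck's theorem.**  Let `δ` be a derivation of `K[x₁,…,x_d]` acting on the
linear span of the variables via a nilpotent matrix `c` (a Weitzenböck derivation).
Then the algebra of constants `K[X_d]^δ` is a finitely generated `K`-algebra. -/
theorem weitzenboeck_theorem (K : Type*) [Field K] [CharZero K] (d : ℕ) (hd : 1 ≤ d)
    (δ : Derivation K (MvPolynomial (Fin d) K) (MvPolynomial (Fin d) K))
    (c : Matrix (Fin d) (Fin d) K)
    (hδ : ∀ i : Fin d, δ (X i) = ∑ j : Fin d, c i j • X j)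
    (hc : IsNilpotent c) :
    ∃ S : Finset (MvPolynomial (Fin d) K),
      (∀ f ∈ S, δ f = 0) ∧
      (Algebra.adjoin K (S : Set (MvPolynomial (Fin d) K)) : Set (MvPolynomial (Fin d) K)) =
        {f : MvPolynomial (Fin d) K | δ f = 0} := by
  obtain ⟨S, hS⟩ := Weitzenboeck.fg_constants_of_isNilpotent hδ hc
  refine ⟨S, fun f hf ↦ ?_, ?_⟩
  · rw [← Weitzenboeck.mem_constants, ← hS]
    exact Algebra.subset_adjoin hf
  · rw [hS]
    ext f
    exact Weitzenboeck.mem_constants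
end

section
/- The Lie algebra of constants F_{2d}^δ = {w ∈ F_{2d} : δ(w) = 0} is not finitely generated as a Lie algebra: there is no finite subset of F_{2d}^δ that generates F_{2d}^δ as a Lie algebra over K. (This is the case of the Drensky–Gupta theorem for the Weitzenböck derivation whose Jordan normal form consists of d Jordan cells of size 2×2 with d ≥ 2, so its matrix has rank d > 1.) -/
noncomputable section

/-- The free metabelian Lie algebra of rank `2d` over `K`: the quotient of the free Lie
algebra on `x₁,…,x_d,y₁,…,y_d` (indexed by `Fin d ⊕ Fin d`) by its second derived ideal. -/
abbrev FreeMetabelian (K : Type*) [Field K] (d : ℕ) :=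
  FreeLieAlgebra K (Fin d ⊕ Fin d) ⧸
    LieAlgebra.derivedSeries K (FreeLieAlgebra K (Fin d ⊕ Fin d)) 2

variable (K : Type*) [Field K] (d : ℕ)

/-- The image of the free generator `xᵢ` in the free metabelian Lie algebra. -/
def xL (i : Fin d) : FreeMetabelian K d :=
  LieSubmodule.Quotient.mk' _ (FreeLieAlgebra.of K (Sum.inl i))

/-- The image of the free generator `yᵢ` in the free metabelian Lie algebra. -/
def yL (i : Fin d) : FreeMetabelian K d :=
  LieSubmodule.Quotient.mk' _ (FreeLieAlgebra.of K (Sum.inr i))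


open Polynomial FreeLieAlgebra

attribute [local instance] LieRing.ofAssociativeRing LieAlgebra.ofAssociativeAlgebra

namespace LieIdeal

variable {R L L' : Type*} [CommRing R] [LieRing L] [LieAlgebra R L] [LieRing L'] [LieAlgebra R L']

/-- A Lie algebra morphism vanishing on an ideal descends to the quotient. -/
def quotientLift (I : LieIdeal R L) (f : L →ₗ⁅R⁆ L') (h : I ≤ f.ker) : (L ⧸ I) →ₗ⁅R⁆ L' :=
  { I.toSubmodule.liftQ (f : L →ₗ[R] L') (fun x hx => LieHom.mem_ker.1 (h hx)) with
    map_lie' := by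
      intro x y
      induction x using Submodule.Quotient.induction_on
      induction y using Submodule.Quotient.induction_on
      exact f.map_lie _ _ }

@[simp]
theorem quotientLift_mk (I : LieIdeal R L) (f : L →ₗ⁅R⁆ L') (h : I ≤ f.ker) (x : L) :
    quotientLift I f h (LieSubmodule.Quotient.mk' I x) = f x :=
  rfl

theorem derivedSeries_one_le_ker_of_comm {A : Type*} [CommRing A] [Algebra R A] (f : L →ₗ⁅R⁆ A) :
    LieAlgebra.derivedSeries R L 1 ≤ f.ker := by
  change ⁅(⊤ : LieIdeal R L), (⊤ : LieIdeal R L)⁆ ≤ f.ker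
  rw [LieSubmodule.lie_le_iff]
  intro x _ y _
  rw [LieHom.mem_ker, LieHom.map_lie, LieRing.of_associative_ring_bracket, mul_comm, sub_self]

theorem derivedSeries_two_le_ker_of_comm {A : Type*} [CommRing A] [Algebra R A] (f : L →ₗ⁅R⁆ A) :
    LieAlgebra.derivedSeries R L 2 ≤ f.ker :=
  (LieAlgebra.derivedSeriesOfIdeal_succ_le ⊤ 1).trans (derivedSeries_one_le_ker_of_comm f)

end LieIdeal

/-- The metabelian Lie algebra of `2 × 2` matrices over `A` with zero bottom row. -/
def affineLie (R A : Type*) [CommRing R] [CommRing A] [Algebra R A] :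
    LieSubalgebra R (Matrix (Fin 2) (Fin 2) A) where
  carrier := {M | M 1 0 = 0 ∧ M 1 1 = 0}
  zero_mem' := by simp
  add_mem' := by
    rintro M N ⟨h1, h2⟩ ⟨h3, h4⟩
    simp [h1, h2, h3, h4]
  smul_mem' := by
    rintro c M ⟨h1, h2⟩
    simp [h1, h2]
  lie_mem' := by
    rintro M N ⟨h1, h2⟩ ⟨h3, h4⟩
    simp [LieRing.of_associative_ring_bracket, Matrix.mul_apply, h1, h2, h3, h4]

namespace affineLie

variable {R A : Type*} [CommRing R] [CommRing A] [Algebra R A]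

/-- The matrix with top row `(a, m)` and zero bottom row. -/
def mk (a m : A) : affineLie R A := ⟨!![a, m; 0, 0], by simp [affineLie]⟩

/-- The linear part of an affine matrix. -/
def linearPart : affineLie R A →ₗ⁅R⁆ A where
  toFun M := M.1 0 0
  map_add' _ _ := rfl
  map_smul' _ _ := rfl
  map_lie' := by
    rintro ⟨M, h1, h2⟩ ⟨N, h3, h4⟩
    simp [LieRing.of_associative_ring_bracket, Matrix.mul_apply, h1, h3, mul_comm]

/-- The translation part of an affine matrix. -/
def translation : affineLie R A →ₗ[R] A where
  toFun M := M.1 0 1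
  map_add' _ _ := rfl
  map_smul' _ _ := rfl

@[simp] theorem linearPart_mk (a m : A) : linearPart (mk a m : affineLie R A) = a := rfl

@[simp] theorem translation_mk (a m : A) : translation (mk a m : affineLie R A) = m := rfl

theorem eq_mk (M : affineLie R A) : M = mk (linearPart M) (translation M) := by
  obtain ⟨M, h1, h2⟩ := M
  apply Subtype.ext
  ext i j
  fin_cases i <;> fin_cases j
  exacts [rfl, rfl, h1, h2]

theorem mk_lie_mk (a m b n : A) :
    ⁅(mk a m : affineLie R A), mk b n⁆ = (mk 0 (a * n - b * m) : affineLie R A) := by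
  apply Subtype.ext
  rw [LieSubalgebra.coe_bracket]
  ext i j
  fin_cases i <;> fin_cases j <;>
    simp [mk, LieRing.of_associative_ring_bracket, mul_comm]

theorem translation_lie (M N : affineLie R A) :
    translation ⁅M, N⁆ = linearPart M * translation N - linearPart N * translation M := by
  rw [eq_mk M, eq_mk N, mk_lie_mk]
  rfl

theorem derivedSeries_two_le_ker {L : Type*} [LieRing L] [LieAlgebra R L]
    (f : L →ₗ⁅R⁆ affineLie R A) : LieAlgebra.derivedSeries R L 2 ≤ f.ker := by
  change ⁅LieAlgebra.derivedSeries R L 1, LieAlgebra.derivedSeries R L 1⁆ ≤ f.ker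
  rw [LieSubmodule.lie_le_iff]
  intro x hx y hy
  have key := LieIdeal.derivedSeries_one_le_ker_of_comm (linearPart.comp f)
  have hx : linearPart (f x) = 0 := LieHom.mem_ker.1 (key hx)
  have hy : linearPart (f y) = 0 := LieHom.mem_ker.1 (key hy)
  rw [LieHom.mem_ker, LieHom.map_lie, eq_mk (f x), eq_mk (f y), mk_lie_mk, hx, hy]
  apply Subtype.ext
  ext i j
  fin_cases i <;> fin_cases j <;> simp [mk]

/-- The affine matrices over `K[X]` with constant linear part and translation part of degree at
most `N`. -/
def bounded (R : Type*) [CommRing R] (N : ℕ) : LieSubalgebra R (affineLie R R[X]) where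
  carrier := {M | (linearPart M).natDegree = 0 ∧ (translation M).natDegree ≤ N}
  zero_mem' := by simp
  add_mem' := by
    rintro M M' ⟨h1, h2⟩ ⟨h3, h4⟩
    refine ⟨?_, ?_⟩
    · have := natDegree_add_le (linearPart M) (linearPart M')
      rw [map_add]; omega
    · have := natDegree_add_le (translation M) (translation M')
      rw [map_add]; omega
  smul_mem' := by
    rintro c M ⟨h1, h2⟩
    refine ⟨?_, ?_⟩
    · have := natDegree_smul_le c (linearPart M)
      rw [map_smul]; omega
    · have := natDegree_smul_le c (translation M)
      rw [map_smul]; omega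
  lie_mem' := by
    rintro M M' ⟨h1, h2⟩ ⟨h3, h4⟩
    refine ⟨?_, ?_⟩
    · rw [LieHom.map_lie, LieRing.of_associative_ring_bracket, mul_comm, sub_self, natDegree_zero]
    · have e1 := natDegree_mul_le (p := linearPart M) (q := translation M')
      have e2 := natDegree_mul_le (p := linearPart M') (q := translation M)
      rw [translation_lie]
      exact (natDegree_sub_le _ _).trans (by omega)

end affineLie

namespace FreeMetabelian

open affineLie

variable {K : Type*} [Field K] {d : ℕ}

/-- The Lie algebra morphism into a commutative algebra with prescribed values on generators. -/
def commLift (f : Fin d ⊕ Fin d → K[X]) : FreeMetabelian K d →ₗ⁅K⁆ K[X] :=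
  LieIdeal.quotientLift _ (lift K f) (LieIdeal.derivedSeries_two_le_ker_of_comm _)

/-- The Lie algebra morphism into the affine matrices with prescribed values on generators. -/
def affineLift (f : Fin d ⊕ Fin d → affineLie K K[X]) : FreeMetabelian K d →ₗ⁅K⁆ affineLie K K[X] :=
  LieIdeal.quotientLift _ (lift K f) (derivedSeries_two_le_ker _)

theorem commLift_xL (f : Fin d ⊕ Fin d → K[X]) (i : Fin d) :
    commLift f (xL K d i) = f (Sum.inl i) := lift_of_apply ..

theorem commLift_yL (f : Fin d ⊕ Fin d → K[X]) (i : Fin d) :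
    commLift f (yL K d i) = f (Sum.inr i) := lift_of_apply ..

theorem affineLift_xL (f : Fin d ⊕ Fin d → affineLie K K[X]) (i : Fin d) :
    affineLift f (xL K d i) = f (Sum.inl i) := lift_of_apply ..

theorem affineLift_yL (f : Fin d ⊕ Fin d → affineLie K K[X]) (i : Fin d) :
    affineLift f (yL K d i) = f (Sum.inr i) := lift_of_apply ..

theorem hom_ext {L : Type*} [LieRing L] [LieAlgebra K L] {f g : FreeMetabelian K d →ₗ⁅K⁆ L}
    (hx : ∀ i, f (xL K d i) = g (xL K d i)) (hy : ∀ i, f (yL K d i) = g (yL K d i)) : f = g := by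
  let q : FreeLieAlgebra K (Fin d ⊕ Fin d) →ₗ⁅K⁆ FreeMetabelian K d :=
    { (LieSubmodule.Quotient.mk' _ : _ →ₗ⁅K, FreeLieAlgebra K (Fin d ⊕ Fin d)⁆
        FreeMetabelian K d) with
      map_lie' := rfl }
  have h : f.comp q = g.comp q := by
    apply FreeLieAlgebra.hom_ext
    rintro (i | i)
    · exact hx i
    · exact hy i
  ext w
  obtain ⟨w, rfl⟩ := LieSubmodule.Quotient.surjective_mk' _ w
  exact LieHom.congr_fun h w

theorem lie_lie_lie_eq_zero (a b c e : FreeMetabelian K d) : ⁅⁅a, b⁆, ⁅c, e⁆⁆ = 0 := by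
  obtain ⟨a, rfl⟩ := LieSubmodule.Quotient.surjective_mk' _ a
  obtain ⟨b, rfl⟩ := LieSubmodule.Quotient.surjective_mk' _ b
  obtain ⟨c, rfl⟩ := LieSubmodule.Quotient.surjective_mk' _ c
  obtain ⟨e, rfl⟩ := LieSubmodule.Quotient.surjective_mk' _ e
  refine (LieSubmodule.Quotient.mk_eq_zero _ (m := ⁅⁅a, b⁆, ⁅c, e⁆⁆)).2 ?_
  exact LieSubmodule.lie_mem_lie
    (LieSubmodule.lie_mem_lie (LieSubmodule.mem_top a) (LieSubmodule.mem_top b))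
    (LieSubmodule.lie_mem_lie (LieSubmodule.mem_top c) (LieSubmodule.mem_top e))

/-- The constant `[xᵢ, xⱼ] (ad xᵢ ad yⱼ - ad xⱼ ad yᵢ)ⁿ`. -/
def witness (K : Type*) [Field K] {d : ℕ} (i j : Fin d) : ℕ → FreeMetabelian K d
  | 0 => ⁅xL K d i, xL K d j⁆
  | n + 1 => ⁅xL K d i, ⁅yL K d j, witness K i j n⁆⁆ - ⁅xL K d j, ⁅yL K d i, witness K i j n⁆⁆

theorem lie_lie_witness (a b : FreeMetabelian K d) (i j : Fin d) (n : ℕ) :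
    ⁅⁅a, b⁆, witness K i j n⁆ = 0 := by
  cases n with
  | zero => exact lie_lie_lie_eq_zero ..
  | succ n => rw [witness, lie_sub, lie_lie_lie_eq_zero, lie_lie_lie_eq_zero, sub_zero]

theorem derivation_witness (δ : LieDerivation K (FreeMetabelian K d) (FreeMetabelian K d))
    (hx : ∀ i : Fin d, δ (xL K d i) = 0) (hy : ∀ i : Fin d, δ (yL K d i) = xL K d i)
    (i j : Fin d) (n : ℕ) : δ (witness K i j n) = 0 := by
  induction n with
  | zero => simp [witness, hx]
  | succ n ih =>
    simp only [witness, map_sub, LieDerivation.apply_lie_eq_add, hx, hy, ih, lie_zero, zero_lie,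
      add_zero, zero_add]
    rw [← lie_lie, lie_lie_witness]

/-- The representation of the free metabelian Lie algebra detecting degree in `yⱼ`. -/
def yDegreeRep (K : Type*) [Field K] {d : ℕ} (i j : Fin d) :
    FreeMetabelian K d →ₗ⁅K⁆ affineLie K K[X] :=
  affineLift (Sum.elim
    (fun k => mk (if k = i then 1 else 0) (if k = j then 1 else 0))
    (fun k => mk (if k = j then X else 0) 0))

theorem yDegreeRep_witness {i j : Fin d} (hij : i ≠ j) (n : ℕ) :
    yDegreeRep K i j (witness K i j n) = mk 0 (X ^ n) := by
  have h1 : yDegreeRep K i j (xL K d i) = mk 1 0 := by simp [yDegreeRep, affineLift_xL, hij]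
  have h2 : yDegreeRep K i j (xL K d j) = mk 0 1 := by simp [yDegreeRep, affineLift_xL, hij.symm]
  have h3 : yDegreeRep K i j (yL K d i) = mk 0 0 := by simp [yDegreeRep, affineLift_yL, hij]
  have h4 : yDegreeRep K i j (yL K d j) = mk X 0 := by simp [yDegreeRep, affineLift_yL]
  induction n with
  | zero => simp [witness, h1, h2, mk_lie_mk]
  | succ n ih =>
    rw [witness, map_sub]
    simp only [LieHom.map_lie, h1, h2, h3, h4, ih, mk_lie_mk]
    rw [eq_mk (_ - _)]
    simp [pow_succ', map_sub]

theorem natDegree_linearPart_yDegreeRep [CharZero K]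
    (δ : LieDerivation K (FreeMetabelian K d) (FreeMetabelian K d))
    (hx : ∀ i : Fin d, δ (xL K d i) = 0) (hy : ∀ i : Fin d, δ (yL K d i) = xL K d i)
    (i j : Fin d) {w : FreeMetabelian K d} (hw : δ w = 0) :
    (linearPart (yDegreeRep K i j w)).natDegree = 0 := by
  let β : FreeMetabelian K d →ₗ⁅K⁆ K[X] :=
    commLift (Sum.elim (fun k => if k = j then 1 else 0) 0)
  have comm (p q : K[X]) : ⁅p, q⁆ = 0 := by
    rw [LieRing.of_associative_ring_bracket, mul_comm, sub_self]
  let f : FreeMetabelian K d →ₗ⁅K⁆ K[X] :=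
    { (derivative : K[X] →ₗ[K] K[X]) ∘ₗ
        ((linearPart.comp (yDegreeRep K i j) : FreeMetabelian K d →ₗ⁅K⁆ K[X]) :
          FreeMetabelian K d →ₗ[K] K[X]) with
      map_lie' := by
        intro u v
        change derivative (linearPart (yDegreeRep K i j ⁅u, v⁆)) = _
        rw [LieHom.map_lie, LieHom.map_lie, comm, comm, derivative_zero] }
  let g : FreeMetabelian K d →ₗ⁅K⁆ K[X] :=
    { (β : FreeMetabelian K d →ₗ[K] K[X]) ∘ₗ (δ : FreeMetabelian K d →ₗ[K] FreeMetabelian K d) with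
      map_lie' := by
        intro u v
        change β (δ ⁅u, v⁆) = _
        rw [LieDerivation.apply_lie_eq_add, map_add, LieHom.map_lie, LieHom.map_lie, comm, comm,
          comm, add_zero] }
  have h : f = g := by
    apply hom_ext
    · intro k
      change derivative (linearPart (yDegreeRep K i j (xL K d k))) = β (δ (xL K d k))
      rw [hx, map_zero, yDegreeRep, affineLift_xL]
      simp only [Sum.elim_inl, linearPart_mk]
      split_ifs <;> simp
    · intro k
      change derivative (linearPart (yDegreeRep K i j (yL K d k))) = β (δ (yL K d k))
      rw [hy, yDegreeRep, affineLift_yL]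
      simp only [β, commLift_xL, Sum.elim_inl, Sum.elim_inr, linearPart_mk]
      split_ifs <;> simp
  have hfw : derivative (linearPart (yDegreeRep K i j w)) = β (δ w) := LieHom.congr_fun h w
  rw [hw, map_zero] at hfw
  exact derivative_eq_zero.1 hfw

end FreeMetabelian

/-- (Drensky–Gupta) The Lie algebra of constants `F_{2d}^δ` of the Weitzenböck
derivation `δ` (`δ(xᵢ) = 0`, `δ(yᵢ) = xᵢ`, `d ≥ 2`) of the free metabelian Lie algebra
`F_{2d}` is not finitely generated as a Lie algebra. -/
theorem constants_not_finitely_generated (K : Type*) [Field K] [CharZero K]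
    (d : ℕ) (hd : 2 ≤ d)
    (δ : LieDerivation K (FreeMetabelian K d) (FreeMetabelian K d))
    (hx : ∀ i : Fin d, δ (xL K d i) = 0)
    (hy : ∀ i : Fin d, δ (yL K d i) = xL K d i) :
    ¬ ∃ S : Finset (FreeMetabelian K d),
        (S : Set (FreeMetabelian K d)) ⊆ {w : FreeMetabelian K d | δ w = 0} ∧
        ((LieSubalgebra.lieSpan K (FreeMetabelian K d) (S : Set (FreeMetabelian K d))) :
            Set (FreeMetabelian K d)) = {w : FreeMetabelian K d | δ w = 0} := by
  rintro ⟨S, hS, hspan⟩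
  let i : Fin d := ⟨0, by omega⟩
  let j : Fin d := ⟨1, by omega⟩
  have hij : i ≠ j := by simp [i, j]
  let Φ := FreeMetabelian.yDegreeRep K i j
  let N := S.sup fun s => (affineLie.translation (Φ s)).natDegree
  have hle : LieSubalgebra.lieSpan K (FreeMetabelian K d) (S : Set (FreeMetabelian K d)) ≤
      (affineLie.bounded K N).comap Φ := by
    rw [LieSubalgebra.lieSpan_le]
    intro s hs
    exact ⟨FreeMetabelian.natDegree_linearPart_yDegreeRep δ hx hy i j (hS hs),
      Finset.le_sup (f := fun s => (affineLie.translation (Φ s)).natDegree) hs⟩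
  have hmem : FreeMetabelian.witness K i j (N + 1) ∈
      ((LieSubalgebra.lieSpan K (FreeMetabelian K d) (S : Set (FreeMetabelian K d))) :
        Set (FreeMetabelian K d)) := by
    rw [hspan]
    exact FreeMetabelian.derivation_witness δ hx hy i j (N + 1)
  have hdeg : (affineLie.translation (Φ (FreeMetabelian.witness K i j (N + 1)))).natDegree ≤ N :=
    (hle hmem).2
  rw [FreeMetabelian.yDegreeRep_witness hij, affineLie.translation_mk, natDegree_X_pow] at hdeg
  omega

end
end
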